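/- arXiv:1403.7814 — 4 statements merged into one kernel-verified Lean document; each statement's English description precedes it below -/
import Mathlib

section
/- Let n ≥ 1 and let U be an n×n complex unitary matrix with eigenvalues λ_1,…,λ_n (with multiplicity). Let a < b ≤ a + 2π be real numbers such that e^{ia} and e^{ib} are not eigenvalues of U. Then the number of indices k ∈ {1,…,n} such that λ_k = e^{iθ} for some θ ∈ (a,b) equals n(b−a)/(2π) − (1/π)·Σ_{k=1}^n [Im(Log(1 − e^{ib}/λ_k)) − Im(Log(1 − e^{ia}/λ_k))], where Log denotes the principal branch of the complex logarithm. -/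
open Complex Real Polynomial

open scoped Matrix.Norms.L2Operator in
lemma norm_root_aux (n : ℕ) (U : Matrix (Fin n) (Fin n) ℂ)
    (hU : U ∈ Matrix.unitaryGroup (Fin n) ℂ) (z : ℂ) (hz : U.charpoly.IsRoot z) : ‖z‖ = 1 := by
  have h1 : z ∈ spectrum ℂ U := Matrix.mem_spectrum_iff_isRoot_charpoly.mpr hz
  have h2 := spectrum.subset_circle_of_unitary hU h1
  simpa using h2

lemma im_log_aux (t : ℝ) (h0 : 0 < t) (h1 : t < 2 * π) :
    (Complex.log (1 - Complex.exp (t * Complex.I))).im = (t - π) / 2 := by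
  have hs : 0 < 2 * Real.sin (t / 2) := by
    have := Real.sin_pos_of_pos_of_lt_pi (x := t / 2) (by linarith) (by linarith)
    linarith
  have key : 1 - Complex.exp (t * Complex.I) = ((2 * Real.sin (t / 2) : ℝ) : ℂ) *
      (Complex.cos (((t - π) / 2 : ℝ) : ℂ) + Complex.sin (((t - π) / 2 : ℝ) : ℂ) * Complex.I) := by
    have e1 : (t - π) / 2 = t / 2 - π / 2 := by ring
    have e2 : t = 2 * (t / 2) := by ring
    rw [e1, ← Complex.ofReal_cos, ← Complex.ofReal_sin, Real.cos_sub_pi_div_two,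
      Real.sin_sub_pi_div_two, Complex.exp_mul_I, ← Complex.ofReal_cos, ← Complex.ofReal_sin]
    have c : Real.cos t = 1 - 2 * Real.sin (t / 2) ^ 2 := by
      conv_lhs => rw [e2, Real.cos_two_mul]
      have := Real.sin_sq_add_cos_sq (t / 2)
      linarith
    have s : Real.sin t = 2 * Real.sin (t / 2) * Real.cos (t / 2) := by
      conv_lhs => rw [e2, Real.sin_two_mul]
    rw [c, s]
    push_cast
    ring
  rw [Complex.log_im, key]
  exact Complex.arg_mul_cos_add_sin_mul_I hs ⟨by linarith, by linarith⟩

lemma im_log_div_aux (t θ : ℝ) (h0 : θ < t) (h1 : t < θ + 2 * π) :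
    (Complex.log (1 - Complex.exp (t * Complex.I) / Complex.exp (θ * Complex.I))).im
      = (t - θ - π) / 2 := by
  rw [← Complex.exp_sub, ← sub_mul, ← Complex.ofReal_sub]
  exact im_log_aux (t - θ) (by linarith) (by linarith)

lemma im_log_div_aux2 (t θ : ℝ) (h0 : t < θ) (h1 : θ < t + 2 * π) :
    (Complex.log (1 - Complex.exp (t * Complex.I) / Complex.exp (θ * Complex.I))).im
      = (t - θ + π) / 2 := by
  have e : Complex.exp (t * Complex.I) = Complex.exp (((t + 2 * π : ℝ) : ℂ) * Complex.I) := by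
    push_cast
    rw [add_mul, Complex.exp_add, Complex.exp_two_pi_mul_I, mul_one]
  rw [e, im_log_div_aux _ _ h1 (by linarith)]
  ring

lemma exists_angle_aux (z : ℂ) (hz : ‖z‖ = 1) (a : ℝ) (ha : z ≠ Complex.exp (a * Complex.I)) :
    ∃ θ : ℝ, a < θ ∧ θ < a + 2 * π ∧ z = Complex.exp (θ * Complex.I) := by
  have hm := toIcoMod_mem_Ico Real.two_pi_pos a z.arg
  have hz' : z = Complex.exp ((toIcoMod Real.two_pi_pos a z.arg : ℝ) * Complex.I) := by
    have h1 : z = Complex.exp (z.arg * Complex.I) := by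
      have := Complex.norm_mul_exp_arg_mul_I z
      rw [hz] at this
      simpa using this.symm
    conv_lhs => rw [h1]
    rw [Complex.exp_eq_exp_iff_exists_int]
    refine ⟨toIcoDiv Real.two_pi_pos a z.arg, ?_⟩
    have h2 := toIcoMod_add_toIcoDiv_zsmul Real.two_pi_pos a z.arg
    conv_lhs => rw [← h2]
    push_cast [zsmul_eq_mul]
    ring
  refine ⟨_, lt_of_le_of_ne hm.1 ?_, hm.2, hz'⟩
  intro h
  rw [← h] at hz'
  exact ha hz'

lemma angle_unique_aux (a x y : ℝ) (hx : a < x) (hx' : x < a + 2 * π) (hy : a < y)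
    (hy' : y < a + 2 * π) (h : Complex.exp (x * Complex.I) = Complex.exp (y * Complex.I)) :
    x = y := by
  rw [Complex.exp_eq_exp_iff_exists_int] at h
  obtain ⟨m, hm⟩ := h
  have h1 : x = y + m * (2 * π) := by
    have := congrArg Complex.im hm
    simpa using this
  have hp := Real.pi_pos
  have m1 : (m : ℝ) < 1 := by by_contra hc; push Not at hc; nlinarith
  have m2 : (-1 : ℝ) < m := by by_contra hc; push Not at hc; nlinarith
  have : m = 0 := by
    have m1' : m < 1 := by exact_mod_cast m1
    have m2' : -1 < m := by exact_mod_cast m2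
    omega
  simpa [this] using h1

theorem eigenvalue_count_via_argument (n : ℕ) (hn : 1 ≤ n)
    (U : Matrix (Fin n) (Fin n) ℂ) (hU : U ∈ Matrix.unitaryGroup (Fin n) ℂ)
    (l : Fin n → ℂ)
    (hspec : (Matrix.charpoly U) = ∏ k : Fin n, (Polynomial.X - Polynomial.C (l k)))
    (a b : ℝ) (hab : a < b) (hba : b ≤ a + 2 * π)
    (ha : ∀ k, l k ≠ Complex.exp (a * Complex.I))
    (hb : ∀ k, l k ≠ Complex.exp (b * Complex.I)) :
    ({k : Fin n | ∃ θ ∈ Set.Ioo a b, l k = Complex.exp (θ * Complex.I)}.ncard : ℝ) =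
      n * (b - a) / (2 * π) -
        (1 / π) * ∑ k : Fin n,
          ((Complex.log (1 - Complex.exp (b * Complex.I) / l k)).im -
            (Complex.log (1 - Complex.exp (a * Complex.I) / l k)).im) := by
  classical
  have hroot : ∀ k, ‖l k‖ = 1 := by
    intro k
    apply norm_root_aux n U hU
    rw [hspec, Polynomial.IsRoot.def, Polynomial.eval_prod]
    exact Finset.prod_eq_zero (Finset.mem_univ k) (by simp)
  have hterm : ∀ k, (if ∃ θ ∈ Set.Ioo a b, l k = Complex.exp (θ * Complex.I) then (1 : ℝ) else 0)
      = (b - a) / (2 * π) - (1 / π) *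
          ((Complex.log (1 - Complex.exp (b * Complex.I) / l k)).im -
            (Complex.log (1 - Complex.exp (a * Complex.I) / l k)).im) := by
    intro k
    obtain ⟨θ, h1, h2, h3⟩ := exists_angle_aux (l k) (hroot k) a (ha k)
    have hp := Real.pi_pos
    have hne : θ ≠ b := by
      rintro rfl
      exact hb k h3
    rcases lt_or_gt_of_ne hne with h | h
    · rw [if_pos ⟨θ, ⟨h1, h⟩, h3⟩, h3, im_log_div_aux b θ h (by linarith),
        im_log_div_aux2 a θ h1 h2]
      field_simp
      ring
    · rw [if_neg, h3, im_log_div_aux2 b θ h (by linarith), im_log_div_aux2 a θ h1 h2]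
      · field_simp
        ring
      · rintro ⟨x, ⟨hx, hx'⟩, he⟩
        have := angle_unique_aux a x θ hx (by linarith) h1 h2 (by rw [← he, h3])
        linarith
  rw [Set.ncard_eq_toFinset_card', Set.toFinset_setOf, Finset.card_filter]
  push_cast
  rw [Finset.sum_congr rfl (fun k _ => hterm k), Finset.sum_sub_distrib, ← Finset.mul_sum]
  simp
  ring
end

section
/- Let n ≥ 1 and let U be an n×n complex unitary matrix such that 1 is not an eigenvalue and all eigenvalues are simple, with eigenangles 0 < θ_1 < θ_2 < … < θ_n < 2π, and set y_k = n·θ_k/(2π) for 1 ≤ k ≤ n. Let 1 ≤ k ≤ n and let ε > 0 be such that no eigenangle of U lies in (0, ε] and none lies in (θ_k, θ_k + ε]. Then k = y_k − (1/π)·[Im log Z(e^{i(θ_k + ε)}) − Im log Z(e^{iε})]. -/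
open Complex Real Polynomial

lemma im_log_pos (φ : ℝ) (h0 : 0 < φ) (h1 : φ < 2 * π) :
    (Complex.log (1 - Complex.exp (φ * Complex.I))).im = (φ - π) / 2 := by
  have hs : 0 < Real.sin (φ / 2) := Real.sin_pos_of_pos_of_lt_pi (by linarith) (by linarith)
  have key : 1 - Complex.exp (φ * Complex.I) =
      ((2 * Real.sin (φ / 2) : ℝ) : ℂ) *
        (Complex.cos (((φ - π) / 2 : ℝ) : ℂ) + Complex.sin (((φ - π) / 2 : ℝ) : ℂ) * Complex.I) := by
    have e1 : (φ - π) / 2 = φ / 2 - π / 2 := by ring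
    have e2 : Real.cos φ = 1 - 2 * Real.sin (φ / 2) ^ 2 := by
      have h := Real.cos_sq_add_sin_sq (φ / 2)
      have h2 := Real.cos_two_mul (φ / 2)
      rw [mul_div_cancel₀ _ two_ne_zero] at h2
      linarith
    have e3 : Real.sin φ = 2 * Real.sin (φ / 2) * Real.cos (φ / 2) := by
      rw [← Real.sin_two_mul]; congr 1; ring
    rw [Complex.exp_mul_I, ← Complex.ofReal_cos, ← Complex.ofReal_sin, ← Complex.ofReal_cos,
      ← Complex.ofReal_sin, e1, Real.cos_sub_pi_div_two, Real.sin_sub_pi_div_two, e2, e3]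
    push_cast
    ring
  rw [Complex.log_im, key, Complex.arg_mul_cos_add_sin_mul_I (by linarith)]
  constructor <;> linarith

lemma im_log_neg (φ : ℝ) (h0 : φ < 0) (h1 : -(2 * π) < φ) :
    (Complex.log (1 - Complex.exp (φ * Complex.I))).im = (φ + π) / 2 := by
  have h := im_log_pos (φ + 2 * π) (by linarith) (by linarith)
  have e : Complex.exp (((φ + 2 * π : ℝ) : ℂ) * Complex.I) = Complex.exp (φ * Complex.I) := by
    push_cast
    rw [add_mul, Complex.exp_periodic]
  rw [e] at h
  rw [h]; ring

theorem index_eq_renormalized_eigenangle_minus_argument (n : ℕ) (hn : 1 ≤ n)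
    (U : Matrix (Fin n) (Fin n) ℂ) (hU : U ∈ Matrix.unitaryGroup (Fin n) ℂ)
    (θ : Fin n → ℝ) (hθmono : StrictMono θ) (hθ : ∀ j, θ j ∈ Set.Ioo 0 (2 * π))
    (hspec : (Matrix.charpoly U) =
      ∏ j : Fin n, (Polynomial.X - Polynomial.C (Complex.exp (θ j * Complex.I))))
    (k : Fin n) (ε : ℝ) (hε : 0 < ε)
    (hε1 : ∀ j, θ j ∉ Set.Ioc 0 ε)
    (hε2 : ∀ j, θ j ∉ Set.Ioc (θ k) (θ k + ε)) :
    ((k : ℕ) + 1 : ℝ) = n * θ k / (2 * π) -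
      (1 / π) *
        (((Complex.log ((-1) ^ n * Matrix.det U)).im +
            ∑ j : Fin n, (Complex.log (1 -
              Complex.exp ((θ k + ε) * Complex.I) / Complex.exp (θ j * Complex.I))).im) -
          ((Complex.log ((-1) ^ n * Matrix.det U)).im +
            ∑ j : Fin n, (Complex.log (1 -
              Complex.exp (ε * Complex.I) / Complex.exp (θ j * Complex.I))).im)) := by
  have hlt : ∀ j, ε < θ j := fun j => by
    by_contra h
    exact hε1 j ⟨(hθ j).1, not_lt.mp h⟩
  have hpi := Real.pi_pos
  have hterm : ∀ j : Fin n,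
      (Complex.log (1 -
        Complex.exp ((θ k + ε) * Complex.I) / Complex.exp (θ j * Complex.I))).im -
      (Complex.log (1 -
        Complex.exp (ε * Complex.I) / Complex.exp (θ j * Complex.I))).im =
      θ k / 2 - if j ≤ k then π else 0 := by
    intro j
    have a1 : Complex.exp ((θ k + ε) * Complex.I) / Complex.exp (θ j * Complex.I) =
        Complex.exp (((θ k + ε - θ j : ℝ) : ℂ) * Complex.I) := by
      rw [← Complex.exp_sub]; push_cast; congr 1; ring
    have a2 : Complex.exp (ε * Complex.I) / Complex.exp (θ j * Complex.I) =
        Complex.exp (((ε - θ j : ℝ) : ℂ) * Complex.I) := by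
      rw [← Complex.exp_sub]; push_cast; congr 1; ring
    have hj := hlt j
    have hj2 := (hθ j).2
    have hk := hθ k
    rw [a1, a2, im_log_neg (ε - θ j) (by linarith) (by linarith)]
    split_ifs with hjk
    · have := hθmono.monotone hjk
      rw [im_log_pos _ (by linarith) (by linarith [hk.2])]
      ring
    · have h3 := hθmono (not_le.mp hjk)
      have h4 : θ k + ε < θ j := by
        by_contra h
        exact hε2 j ⟨h3, not_lt.mp h⟩
      rw [im_log_neg _ (by linarith) (by linarith [hk.1])]
      ring
  rw [add_sub_add_left_eq_sub, ← Finset.sum_sub_distrib, Finset.sum_congr rfl fun j _ => hterm j,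
    Finset.sum_sub_distrib, ← Finset.sum_filter]
  have hc : (Finset.univ.filter fun j : Fin n => j ≤ k).card = (k : ℕ) + 1 := by
    rw [Finset.filter_ge_eq_Iic, Fin.card_Iic]
  rw [Finset.sum_const, Finset.sum_const, hc]
  simp only [Finset.card_univ, Fintype.card_fin, nsmul_eq_mul]
  push_cast
  field_simp
  ring
end

section
/- Let n ≥ 1 and let μ_n denote the normalized Haar probability measure on the group U(n) of n×n complex unitary matrices. Define X_n(U) = Σ_{k=1}^n Im(Log(1 − λ_k(U)^{−1})), where λ_1(U),…,λ_n(U) are the eigenvalues of U and Log is the principal branch of the complex logarithm (this is defined for μ_n-almost every U, namely whenever 1 is not an eigenvalue). Then for every x > 0, μ_n({U : |X_n(U)| ≥ x}) ≤ 2·exp(−x²/(C + log n)), where C = π²/6 + 1. -/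
open MeasureTheory Matrix Complex Real

noncomputable instance (n : ℕ) : MeasurableSpace (Matrix.unitaryGroup (Fin n) ℂ) :=
  borel _

instance (n : ℕ) : BorelSpace (Matrix.unitaryGroup (Fin n) ℂ) := ⟨rfl⟩

namespace CB
open Filter Topology Set

lemma lift_zero (D : ℝ → ℂ) (hD : ContinuousOn D (Icc 0 1)) (h1 : ∀ t ∈ Icc (0:ℝ) 1, Complex.exp (D t) = 1)
    (h0 : D 0 = 0) : D 1 = 0 := by
  have key : ∀ t ∈ Icc (0:ℝ) 1, ∃ n : ℤ, D t = n * (2 * π * I) := fun t ht => Complex.exp_eq_one_iff.1 (h1 t ht)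
  obtain ⟨n, hn⟩ := key 1 (by simp)
  by_contra hne
  have hn0 : n ≠ 0 := by
    rintro rfl; apply hne; rw [hn]; simp
  set f : ℝ → ℝ := fun t => (D t).im / (2 * π) with hf
  have hfc : ContinuousOn f (Icc 0 1) := (Complex.continuous_im.comp_continuousOn hD).div_const _
  have hfi : ∀ t ∈ Icc (0:ℝ) 1, ∃ n : ℤ, f t = n := by
    intro t ht
    obtain ⟨m, hm⟩ := key t ht
    refine ⟨m, ?_⟩
    simp only [hf, hm]
    simp
  have hf0 : f 0 = 0 := by simp [hf, h0]
  have hf1 : f 1 = n := by simp only [hf, hn]; simp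
  have hiv := intermediate_value_uIcc (a := (0:ℝ)) (b := 1) (f := f) (by simpa using hfc)
  rw [hf0, hf1] at hiv
  have hlt : n < 0 ∨ 0 < n := lt_or_gt_of_ne hn0
  have : ∃ y ∈ uIcc (0:ℝ) n, ∀ m : ℤ, y ≠ m := by
    rcases hlt with h | h
    · refine ⟨-1/2, ?_, ?_⟩
      · rw [mem_uIcc]; right
        have : (n:ℝ) ≤ -1 := by exact_mod_cast (by omega : n ≤ -1)
        constructor <;> linarith
      · intro m hm
        have h2 : (2 * m : ℝ) = -1 := by linarith
        have : 2 * m = -1 := by exact_mod_cast h2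
        omega
    · refine ⟨1/2, ?_, ?_⟩
      · rw [mem_uIcc]; left
        have : (1:ℝ) ≤ n := by exact_mod_cast (by omega : 1 ≤ n)
        constructor <;> linarith
      · intro m hm
        have h2 : (2 * m : ℝ) = 1 := by linarith
        have : 2 * m = 1 := by exact_mod_cast h2
        omega
  obtain ⟨y, hy, hym⟩ := this
  obtain ⟨t, ht, rfl⟩ := hiv hy
  rw [uIcc_of_le zero_le_one] at ht
  obtain ⟨m, hm⟩ := hfi t ht
  exact hym m hm

variable {ι κ : Type*} [Fintype ι] [DecidableEq ι] [Fintype κ] [DecidableEq κ]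

/-- sum of `log (1 - ρ λ)` over the eigenvalues -/
noncomputable def Lc (ρ : ℝ) (A : Matrix ι ι ℂ) : ℂ :=
  (A.charpoly.roots.map (fun l => Complex.log (1 - ρ * l))).sum

lemma det_one_sub_smul' (A : Matrix ι ι ℂ) (ρ : ℂ) :
    det (1 - ρ • A) = (A.charpoly.roots.map (fun l => 1 - ρ * l)).prod := by
  have hs : A.charpoly.Splits := IsAlgClosed.splits _
  have hcard : A.charpoly.roots.card = Fintype.card ι := by
    rw [← hs.natDegree_eq_card_roots, Matrix.charpoly_natDegree_eq_dim]
  have hev : ∀ z : ℂ, det (z • (1 : Matrix ι ι ℂ) - A) = (A.charpoly.roots.map (fun l => z - l)).prod := by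
    intro z
    have h := hs.eq_prod_roots_of_monic A.charpoly_monic
    have h2 : A.charpoly.eval z = det (z • (1 : Matrix ι ι ℂ) - A) := by
      rw [Matrix.eval_charpoly, scalar_apply, ← Matrix.smul_one_eq_diagonal]
    rw [← h2]
    conv_lhs => rw [h]
    rw [Polynomial.eval_multiset_prod, Multiset.map_map]
    simp
  by_cases h : ρ = 0
  · subst h; simp
  · have : (1 - ρ • A) = ρ • (ρ⁻¹ • (1 : Matrix ι ι ℂ) - A) := by
      rw [smul_sub, smul_smul, mul_inv_cancel₀ h, one_smul]
    rw [this, Matrix.det_smul, hev, ← hcard]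
    have h3 : (A.charpoly.roots.map (fun l => 1 - ρ * l)) = A.charpoly.roots.map (fun l => ρ * (ρ⁻¹ - l)) := by
      apply Multiset.map_congr rfl
      intro l _
      field_simp
    rw [h3, Multiset.prod_map_mul, Multiset.map_const', Multiset.prod_replicate]

lemma lc_zero (A : Matrix ι ι ℂ) : Lc 0 A = 0 := by simp [Lc]

/-- all eigenvalues in the closed disc and none equal to one -/
def Good (A : Matrix ι ι ℂ) : Prop := ∀ l ∈ A.charpoly.roots, ‖l‖ ≤ 1 ∧ l ≠ 1

lemma slit_of (ρ : ℝ) (h0 : 0 ≤ ρ) (h1 : ρ ≤ 1) (l : ℂ) (hl : ‖l‖ ≤ 1) (hl1 : l ≠ 1) :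
    1 - (ρ:ℂ) * l ∈ slitPlane := by
  rw [Complex.mem_slitPlane_iff]
  left
  have h2 : l.re ≤ ‖l‖ := Complex.re_le_norm l
  have h3 : l.re < 1 := by
    rcases lt_or_eq_of_le (h2.trans hl) with h | h
    · exact h
    · exfalso; apply hl1
      have : ‖l‖ = 1 := le_antisymm hl (h ▸ h2)
      have h5 : l.re^2 + l.im^2 = 1 := by
        have := Complex.sq_norm l
        rw [Complex.normSq_apply, ‹‖l‖ = 1›] at this; nlinarith
      have : l.im = 0 := by rw [h] at h5; nlinarith
      apply Complex.ext <;> simp [h, this]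
  have h6 : ρ * l.re < 1 := by
    rcases le_or_gt l.re 0 with h | h
    · nlinarith
    · nlinarith
  simpa using h6

lemma Good.lc_cont {A : Matrix ι ι ℂ} (hA : Good A) : ContinuousOn (fun ρ : ℝ => Lc ρ A) (Icc 0 1) := by
  unfold Lc
  have : ∀ s : Multiset ℂ, (∀ l ∈ s, ‖l‖ ≤ 1 ∧ l ≠ 1) →
      ContinuousOn (fun ρ : ℝ => (s.map (fun l => Complex.log (1 - ρ * l))).sum) (Icc 0 1) := by
    intro s
    induction s using Multiset.induction_on with
    | empty => intro _; simp; exact continuousOn_const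
    | cons a s ih =>
      intro h
      simp only [Multiset.map_cons, Multiset.sum_cons]
      refine ContinuousOn.add ?_ (ih fun l hl => h l (Multiset.mem_cons_of_mem hl))
      refine ContinuousOn.clog (by fun_prop) ?_
      intro ρ hρ
      have := h a (Multiset.mem_cons_self _ _)
      exact slit_of ρ hρ.1 hρ.2 a this.1 this.2
  exact this _ hA

lemma Good.exp_lc {A : Matrix ι ι ℂ} (hA : Good A) {ρ : ℝ} (h : ρ ∈ Icc (0:ℝ) 1) :
    Complex.exp (Lc ρ A) = det (1 - (ρ:ℂ) • A) := by
  rw [det_one_sub_smul', Lc, Complex.exp_multiset_sum, Multiset.map_map]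
  congr 1
  apply Multiset.map_congr rfl
  intro l hl
  exact Complex.exp_log (slitPlane_ne_zero (slit_of ρ h.1 h.2 l (hA l hl).1 (hA l hl).2))

lemma Good.det_ne {A : Matrix ι ι ℂ} (hA : Good A) {ρ : ℝ} (h : ρ ∈ Icc (0:ℝ) 1) :
    det (1 - (ρ:ℂ) • A) ≠ 0 := by
  rw [← hA.exp_lc h]; exact Complex.exp_ne_zero _

lemma continuous_lc {X : Type*} [TopologicalSpace X] (A : X → Matrix ι ι ℂ) (hA : Continuous A)
    (hg : ∀ x, Good (A x)) : Continuous (fun x => Lc 1 (A x)) := by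
  rw [continuous_iff_continuousAt]
  intro x0
  have hinner : Continuous (fun p : X × ℝ => det (1 - ((p.2 : ℝ):ℂ) • A p.1)) := by
    apply Continuous.matrix_det
    fun_prop
  have hinner0 : Continuous (fun p : X × ℝ => det (1 - ((p.2 : ℝ):ℂ) • A x0)) := by
    apply Continuous.matrix_det
    fun_prop
  set q : X → ℝ → ℂ := fun x ρ => det (1 - (ρ:ℂ) • A x) / det (1 - (ρ:ℂ) • A x0) with hq
  have hqc : ∀ x, ∀ ρ ∈ Icc (0:ℝ) 1, ContinuousAt (fun p : X × ℝ => q p.1 p.2) (x, ρ) := by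
    intro x ρ hρ
    exact hinner.continuousAt.div hinner0.continuousAt ((hg x0).det_ne hρ)
  have hq1 : ∀ ρ ∈ Icc (0:ℝ) 1, q x0 ρ = 1 := fun ρ hρ => div_self ((hg x0).det_ne hρ)
  have hev : ∀ᶠ x in 𝓝 x0, ∀ ρ ∈ Icc (0:ℝ) 1, q x ρ ∈ slitPlane := by
    apply isCompact_Icc.eventually_forall_of_forall_eventually
    intro ρ hρ
    have := hqc x0 ρ hρ
    apply this.eventually
    apply Complex.isOpen_slitPlane.mem_nhds
    simp only [hq1 ρ hρ]
    exact one_mem_slitPlane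
  have hone : (1:ℝ) ∈ Icc (0:ℝ) 1 := by simp
  have heq : ∀ᶠ x in 𝓝 x0, Lc 1 (A x) = Lc 1 (A x0) + Complex.log (q x 1) := by
    filter_upwards [hev] with x hx
    have := lift_zero (fun ρ => Lc ρ (A x) - Lc ρ (A x0) - Complex.log (q x ρ)) ?_ ?_ ?_
    · linear_combination this
    · refine ((hg x).lc_cont.sub (hg x0).lc_cont).sub ?_
      refine ContinuousOn.clog ?_ hx
      intro ρ hρ
      apply ContinuousAt.continuousWithinAt
      have h1 : ContinuousAt (fun ρ : ℝ => (x, ρ)) ρ := by fun_prop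
      exact ContinuousAt.comp (f := fun ρ : ℝ => (x, ρ)) (g := fun p : X × ℝ => q p.1 p.2) (hqc x ρ hρ) h1
    · intro ρ hρ
      rw [Complex.exp_sub, Complex.exp_sub, (hg x).exp_lc hρ, (hg x0).exp_lc hρ,
        Complex.exp_log (slitPlane_ne_zero (hx ρ hρ))]
      exact div_self (slitPlane_ne_zero (hx ρ hρ))
    · simp [lc_zero, hq]
  refine ContinuousAt.congr ?_ (heq.mono fun x h => h.symm)
  refine continuousAt_const.add ?_
  refine ContinuousAt.clog ?_ ?_
  · exact ContinuousAt.comp (f := fun x : X => (x, (1:ℝ))) (g := fun p : X × ℝ => q p.1 p.2) (hqc x0 1 hone) (by fun_prop)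
  · rw [hq1 1 hone]; exact one_mem_slitPlane

/-- contraction for the euclidean norm -/
lemma good_of {A : Matrix ι ι ℂ} (h : ∀ x : ι → ℂ, ∑ i, ‖(A *ᵥ x) i‖^2 ≤ ∑ i, ‖x i‖^2)
    (hd : det (1 - A) ≠ 0) : Good A := by
  intro l hl
  constructor
  · have hl' : Module.End.HasEigenvalue (Matrix.toLin' A) l := by
      rw [Module.End.hasEigenvalue_iff_isRoot_charpoly, Matrix.charpoly_toLin']
      exact (Polynomial.mem_roots'.1 hl).2
    obtain ⟨x, hx⟩ := hl'.exists_hasEigenvector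
    have hx1 : A *ᵥ x = l • x := by simpa using hx.apply_eq_smul
    have hx2 : x ≠ 0 := hx.2
    have h3 := h x
    rw [hx1] at h3
    simp only [Pi.smul_apply, smul_eq_mul, norm_mul, mul_pow] at h3
    rw [← Finset.mul_sum] at h3
    have hpos : 0 < ∑ i, ‖x i‖^2 := by
      obtain ⟨i, hi⟩ := Function.ne_iff.1 hx2
      exact Finset.sum_pos' (fun _ _ => by positivity) ⟨i, Finset.mem_univ _, by
        have : 0 < ‖x i‖ := norm_pos_iff.2 hi
        positivity⟩
    have : ‖l‖^2 ≤ 1 := by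
      by_contra hcon
      push Not at hcon
      nlinarith
    have h0 := norm_nonneg l
    nlinarith
  · rintro rfl
    apply hd
    have := det_one_sub_smul' A 1
    rw [one_smul] at this
    rw [this]
    apply Multiset.prod_eq_zero
    rw [Multiset.mem_map]
    exact ⟨1, hl, by simp⟩

lemma unitary_norm {U : Matrix ι ι ℂ} (hU : U ∈ unitaryGroup ι ℂ) (x : ι → ℂ) :
    ∑ i, ‖(U *ᵥ x) i‖^2 = ∑ i, ‖x i‖^2 := by
  have h : ∀ y : ι → ℂ, star y ⬝ᵥ y = ((∑ i, ‖y i‖^2 : ℝ) : ℂ) := by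
    intro y
    simp [dotProduct, Complex.conj_mul']
  have h2 : star (U *ᵥ x) ⬝ᵥ (U *ᵥ x) = star x ⬝ᵥ x := by
    rw [star_mulVec, dotProduct_mulVec, vecMul_vecMul]
    have := mem_unitaryGroup_iff'.1 hU
    rw [star_eq_conjTranspose] at this
    rw [this, vecMul_one]
  rw [h, h] at h2
  exact_mod_cast h2

lemma good_unitary {U : Matrix ι ι ℂ} (hU : U ∈ unitaryGroup ι ℂ) (hd : det (1 - U) ≠ 0) : Good U :=
  good_of (fun x => (unitary_norm hU x).le) hd

lemma det_block {H : Matrix (Unit ⊕ κ) (Unit ⊕ κ) ℂ} (w v : Unit ⊕ κ → ℂ)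
    (hH : H = 1 + vecMulVec w v) (h1 : H (.inl ()) (.inl ()) ≠ 1) (A : Matrix κ κ ℂ) :
    det (1 - H * fromBlocks 1 0 0 A) = (1 - H (.inl ()) (.inl ())) * det (1 - A) := by
  set c := w (.inl ()) * v (.inl ()) with hc
  have hH11 : H (.inl ()) (.inl ()) = 1 + c := by rw [hH]; simp [vecMulVec_apply, hc]
  have hc0 : c ≠ 0 := by rintro h; apply h1; rw [hH11, h]; simp
  set w' : κ → ℂ := fun i => w (.inr i)
  set v' : κ → ℂ := fun i => v (.inr i)
  have hN : 1 - H * fromBlocks 1 0 0 A =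
      fromBlocks (diagonal fun _ : Unit => -c) (-vecMulVec (fun _ => w (.inl ())) (v' ᵥ* A))
        (-vecMulVec w' (fun _ => v (.inl ()))) (1 - A - vecMulVec w' (v' ᵥ* A)) := by
    rw [hH, add_mul, one_mul, vecMulVec_mul]
    ext i j
    rcases i with i | i <;> rcases j with j | j <;>
      simp [vecMulVec_apply, vecMul, dotProduct, one_apply, hc, w', v', Matrix.sub_apply]
    ring
  letI : Invertible (diagonal fun _ : Unit => -c) :=
    ⟨diagonal fun _ : Unit => (-c)⁻¹, by simp [hc0], by simp [hc0]⟩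
  have hinv : ⅟(diagonal fun _ : Unit => -c) = diagonal fun _ : Unit => (-c)⁻¹ := rfl
  rw [hN, det_fromBlocks₁₁, hinv, hH11]
  congr 1
  · simp
  · congr 1
    ext i j
    simp [Matrix.mul_apply, vecMulVec_apply, w']
    have : w (Sum.inr i) * v (Sum.inl ()) * c⁻¹ * (w (Sum.inl ()) * (v' ᵥ* A) j) = w (Sum.inr i) * (v' ᵥ* A) j * (c * c⁻¹) := by
      rw [hc]; ring
    rw [mul_inv_cancel₀ hc0] at this
    linear_combination this

lemma lc_block {H : Matrix (Unit ⊕ κ) (Unit ⊕ κ) ℂ} (w v : Unit ⊕ κ → ℂ)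
    (hH : H = 1 + vecMulVec w v) (hHu : H ∈ unitaryGroup (Unit ⊕ κ) ℂ)
    (h1 : H (.inl ()) (.inl ()) ≠ 1) (V : Matrix κ κ ℂ)
    (hV : V ∈ unitaryGroup κ ℂ) (hd : det (1 - V) ≠ 0) :
    Lc 1 (H * fromBlocks 1 0 0 V) = Complex.log (1 - H (.inl ()) (.inl ())) + Lc 1 V := by
  have hgV := good_unitary hV hd
  set γ := H (.inl ()) (.inl ()) with hγ
  have hcontr : ∀ r ∈ Icc (0:ℝ) 1, Good (H * fromBlocks 1 0 0 ((r:ℂ) • V)) := by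
    intro r hr
    refine good_of ?_ ?_
    · intro x
      rw [← mulVec_mulVec, unitary_norm hHu, Fintype.sum_sum_type, Fintype.sum_sum_type, fromBlocks_mulVec]
      refine add_le_add ?_ ?_
      · simp
      · simp only [Sum.elim_inr, zero_mulVec, zero_add, smul_mulVec, Pi.smul_apply, norm_smul]
        refine le_trans ?_ (unitary_norm hV (x ∘ Sum.inr)).le
        refine Finset.sum_le_sum fun i _ => ?_
        have : ‖(r:ℂ)‖ ≤ 1 := by simpa [abs_of_nonneg hr.1] using hr.2
        have h3 := norm_nonneg ((V *ᵥ (x ∘ Sum.inr)) i)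
        have h4 := norm_nonneg (r:ℂ)
        have : ‖(r:ℂ)‖ * ‖(V *ᵥ (x ∘ Sum.inr)) i‖ ≤ ‖(V *ᵥ (x ∘ Sum.inr)) i‖ := by nlinarith
        gcongr
    · rw [det_block w v hH h1]
      exact mul_ne_zero (sub_ne_zero.2 (Ne.symm h1)) (hgV.det_ne hr)
  have hγn : ‖γ‖ ≤ 1 := entry_norm_bound_of_unitary hHu _ _
  have hone : (1:ℝ) ∈ Icc (0:ℝ) 1 := by simp
  have hzero : (0:ℝ) ∈ Icc (0:ℝ) 1 := by simp
  -- step zero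
  have hg0 : Good (H * fromBlocks 1 0 0 (0 : Matrix κ κ ℂ)) := by
    have := hcontr 0 hzero
    simpa using this
  have hstart : Lc 1 (H * fromBlocks 1 0 0 (0 : Matrix κ κ ℂ)) = Complex.log (1 - γ) := by
    have := lift_zero (fun ρ => Lc ρ (H * fromBlocks 1 0 0 (0 : Matrix κ κ ℂ)) - Complex.log (1 - ρ * γ)) ?_ ?_ ?_
    · simp only [ofReal_one, one_mul] at this
      linear_combination this
    · refine hg0.lc_cont.sub (ContinuousOn.clog (by fun_prop) ?_)
      intro ρ hρ
      exact slit_of ρ hρ.1 hρ.2 γ hγn h1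
    · intro ρ hρ
      have hs := slitPlane_ne_zero (slit_of ρ hρ.1 hρ.2 γ hγn h1)
      rw [Complex.exp_sub, hg0.exp_lc hρ, Complex.exp_log hs]
      have : (1 - (ρ:ℂ) • (H * fromBlocks 1 0 0 (0 : Matrix κ κ ℂ))) =
         fromBlocks (diagonal fun _ : Unit => 1 - ρ * γ) 0 (-((ρ:ℂ) • H.toBlocks₂₁)) 1 := by
        conv_lhs => rw [← fromBlocks_toBlocks H, fromBlocks_multiply]
        ext i j
        rcases i with i | i <;> rcases j with j | j <;> simp [one_apply, toBlocks₁₁, hγ]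
      rw [this, det_fromBlocks_zero₁₂]
      simp [div_self hs]
    · simp [lc_zero]
  have hcont : ContinuousOn (fun r : ℝ => Lc 1 (H * fromBlocks 1 0 0 ((r:ℂ) • V))) (Icc 0 1) := by
    rw [continuousOn_iff_continuous_domRestrict]
    refine continuous_lc (X := Icc (0:ℝ) 1) (fun r => H * fromBlocks 1 0 0 (((r:ℝ):ℂ) • V)) ?_ (fun r => hcontr r r.2)
    refine continuous_const.mul (Continuous.matrix_fromBlocks continuous_const continuous_const continuous_const ?_)
    fun_prop
  have := lift_zero (fun r => Lc 1 (H * fromBlocks 1 0 0 ((r:ℂ) • V)) - Complex.log (1 - γ) - Lc r V) ?_ ?_ ?_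
  · simp only [ofReal_one, one_smul] at this
    linear_combination this
  · exact (hcont.sub continuousOn_const).sub hgV.lc_cont
  · intro r hr
    have h3 := (hcontr r hr).exp_lc hone
    rw [Complex.exp_sub, Complex.exp_sub, h3, hgV.exp_lc hr, Complex.exp_log (sub_ne_zero.2 (Ne.symm h1))]
    simp only [ofReal_one, one_smul]
    rw [det_block w v hH h1]
    have := hgV.det_ne hr
    have := sub_ne_zero.2 (Ne.symm h1)
    field_simp
    try rw [← hγ]
    try exact div_self this
  · simp [hstart, lc_zero]

end CB

namespace CB
open Filter Topology Set

/-- Taylor coefficients of `(1 - z) ^ (- i y)` -/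
noncomputable def cf (y : ℝ) (k : ℕ) : ℂ := Ring.choose (-(I * y) : ℂ) k * (-1) ^ k

lemma cf_zero (y : ℝ) : cf y 0 = 1 := by simp [cf]

lemma cf_succ (y : ℝ) (k : ℕ) : cf y (k+1) = cf y k * ((k + I * y) / (k + 1)) := by
  unfold cf
  set a : ℂ := -(I * y)
  have h1 := Ring.descPochhammer_eq_factorial_smul_choose a k
  have h2 := Ring.descPochhammer_eq_factorial_smul_choose a (k+1)
  have h3 : (descPochhammer ℤ (k+1)).smeval a = (descPochhammer ℤ k).smeval a * (a - k) := by
    simp [descPochhammer_succ_right, Polynomial.smeval_mul, Polynomial.smeval_natCast]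
  rw [h1, h2] at h3
  simp only [nsmul_eq_mul, Nat.factorial_succ] at h3
  push_cast at h3
  have hk : ((k.factorial : ℕ) : ℂ) ≠ 0 := by exact_mod_cast k.factorial_ne_zero
  have hk1 : ((k:ℂ) + 1) ≠ 0 := by exact_mod_cast k.succ_ne_zero
  have h4 : Ring.choose a (k+1) = Ring.choose a k * ((a - k)/(k+1)) := by
    have h5 : (k.factorial : ℂ) * ((k+1) * Ring.choose a (k+1)) = k.factorial * (Ring.choose a k * (a - k)) := by
      linear_combination h3
    have h6 := mul_left_cancel₀ hk h5
    field_simp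
    linear_combination h6
  rw [h4, pow_succ]
  field_simp
  simp only [a]
  ring

lemma cf_norm_succ (y : ℝ) (k : ℕ) : ‖cf y (k+1)‖^2 = ‖cf y k‖^2 * ((k^2 + y^2)/(k+1)^2) := by
  rw [cf_succ, norm_mul, norm_div, mul_pow, div_pow]
  congr 2
  · rw [Complex.sq_norm, Complex.normSq_apply]; simp; ring
  · rw [Complex.sq_norm, Complex.normSq_apply]; simp; ring

lemma cf_hasSum (y : ℝ) (z : ℂ) (hz : ‖z‖ < 1) :
    HasSum (fun k => cf y k * z ^ k) ((1 - z) ^ (-(I * y) : ℂ)) := by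
  have h := (Complex.one_add_cpow_hasFPowerSeriesOnBall_zero (a := -(I * y))).hasSum (y := -z)
    (by
      rw [← ENNReal.ofReal_one, Metric.eball_ofReal]; simpa using hz)
  simp only [zero_add] at h
  rw [← sub_eq_add_neg] at h
  have e : (fun k => cf y k * z ^ k) = fun n => (binomialSeries ℂ (-(I * y) : ℂ) n) fun _ => -z := by
    funext k
    rw [binomialSeries_apply]
    simp [cf, neg_pow z k, mul_assoc]
  rw [e]; exact h

lemma exp_im_log (s : ℝ) (z : ℂ) (hz : z ≠ 0) :
    Real.exp (s * (Complex.log z).im) = ‖z ^ (-(I * ((s/2 : ℝ) : ℂ)) : ℂ)‖^2 := by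
  rw [Complex.cpow_def_of_ne_zero hz, Complex.norm_exp, ← Real.exp_nat_mul]
  congr 1
  simp
  ring

/-- the moments of the modulus of an entry -/
noncomputable def mom (n : ℕ) : ℕ → ℝ
  | 0 => 1
  | k + 1 => mom n k * ((k + 1) / (n + k))

lemma mom_nonneg (n k : ℕ) : 0 ≤ mom n k := by
  induction k with
  | zero => simp [mom]
  | succ k ih => rw [mom]; positivity

lemma mom_shift (n : ℕ) (hn : 1 ≤ n) (k : ℕ) : mom (n+1) k = mom n k * (n / (n + k)) := by
  have hn' : (0:ℝ) < n := by exact_mod_cast hn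
  induction k with
  | zero => simp [mom]; field_simp
  | succ k ih =>
    rw [mom, mom, ih]
    push_cast
    field_simp
    ring

noncomputable def SS (y : ℝ) (n K : ℕ) : ℝ := ∑ k ∈ Finset.range K, ‖cf y k‖^2 * mom n k

lemma SS_step_eq (y : ℝ) (n : ℕ) (hn : 1 ≤ n) (K : ℕ) :
    SS y n K = (1 + y^2/n^2) * SS y (n+1) K - K * (‖cf y K‖^2 * mom n K) / n := by
  have hn' : (0:ℝ) < n := by exact_mod_cast hn
  unfold SS
  induction K with
  | zero => simp
  | succ K ih =>
    rw [Finset.sum_range_succ, ih, Finset.sum_range_succ, cf_norm_succ, mom_shift n hn, mom]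
    push_cast
    field_simp
    ring

lemma SS_step (y : ℝ) (n : ℕ) (hn : 1 ≤ n) (K : ℕ) :
    SS y n K ≤ Real.exp (y^2 * (1 / (n:ℝ)^2)) * SS y (n+1) K := by
  rw [SS_step_eq y n hn K]
  have h1 : 0 ≤ K * (‖cf y K‖^2 * mom n K) / n := by
    have := mom_nonneg n K
    positivity
  have h2 : 0 ≤ SS y (n+1) K := Finset.sum_nonneg fun k _ => mul_nonneg (by positivity) (mom_nonneg _ _)
  have h3 : 1 + y^2/n^2 ≤ Real.exp (y^2 * (1 / (n:ℝ)^2)) := by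
    have := Real.add_one_le_exp (y^2 * (1 / (n:ℝ)^2))
    have e : y^2/(n:ℝ)^2 = y^2 * (1 / (n:ℝ)^2) := by ring
    linarith
  nlinarith [mul_le_mul_of_nonneg_right h3 h2]

lemma SS_iter (y : ℝ) (n : ℕ) (hn : 1 ≤ n) (K M : ℕ) :
    SS y n K ≤ Real.exp (y^2 * ∑ m ∈ Finset.range M, 1 / ((n + m : ℕ):ℝ)^2) * SS y (n+M) K := by
  induction M with
  | zero => simp
  | succ M ih =>
    refine ih.trans ?_
    rw [Finset.sum_range_succ, mul_add, Real.exp_add, mul_assoc]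
    gcongr
    exact SS_step y (n+M) (by omega) K

noncomputable def TT (n : ℕ) : ℝ := ∑' m : ℕ, 1 / ((n + m : ℕ):ℝ)^2

lemma TT_summable (n : ℕ) : Summable (fun m : ℕ => 1 / ((n + m : ℕ):ℝ)^2) := by
  have h := hasSum_zeta_two.summable
  have := (summable_nat_add_iff n).2 h
  simpa [add_comm] using this

lemma mom_tendsto (n k : ℕ) : Tendsto (fun M : ℕ => mom (n + M) k) atTop (𝓝 (if k = 0 then 1 else 0)) := by
  induction k with
  | zero => simp [mom]
  | succ k ih =>
    simp only [mom]
    have h : Tendsto (fun M : ℕ => ((k:ℝ)+1) / (((n + M : ℕ):ℝ) + k)) atTop (𝓝 0) := by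
      apply Tendsto.const_div_atTop
      apply tendsto_atTop_add_const_right
      apply tendsto_natCast_atTop_atTop.comp
      exact tendsto_atTop_mono (fun M => Nat.le_add_left M n) tendsto_id
    simpa using ih.mul h

lemma SS_le (y : ℝ) (n : ℕ) (hn : 1 ≤ n) (K : ℕ) : SS y n K ≤ Real.exp (y^2 * TT n) := by
  have h1 : Tendsto (fun M => SS y (n+M) K) atTop (𝓝 (∑ k ∈ Finset.range K, ‖cf y k‖^2 * (if k = 0 then 1 else 0))) := by
    apply tendsto_finsetSum
    intro k _
    exact (mom_tendsto n k).const_mul _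
  have h2 : (∑ k ∈ Finset.range K, ‖cf y k‖^2 * (if k = 0 then (1:ℝ) else 0)) ≤ 1 := by
    simp only [mul_ite, mul_one, mul_zero, Finset.sum_ite_eq', Finset.mem_range]
    split_ifs
    · simp [cf_zero]
    · norm_num
  have h3 : ∀ M, SS y n K ≤ Real.exp (y^2 * TT n) * SS y (n+M) K := by
    intro M
    refine (SS_iter y n hn K M).trans ?_
    have h2 : 0 ≤ SS y (n+M) K := Finset.sum_nonneg fun k _ => mul_nonneg (by positivity) (mom_nonneg _ _)
    gcongr
    exact (TT_summable n).sum_le_tsum _ (fun _ _ => by positivity)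
  have h4 := ge_of_tendsto' (h1.const_mul (Real.exp (y^2 * TT n))) h3
  refine h4.trans ?_
  have := Real.exp_pos (y^2 * TT n)
  nlinarith

lemma TT_one : TT 1 = π^2/6 := by
  have h := hasSum_zeta_two
  have h2 := (hasSum_nat_add_iff' 1).2 h
  simp only [Finset.sum_range_one] at h2
  unfold TT
  have := h2.tsum_eq
  simp only [add_comm 1]
  rw [this]; simp

lemma TT_le (n : ℕ) (hn : 1 ≤ n) : TT (n+1) ≤ 1 / n := by
  have hn' : (0:ℝ) < n := by exact_mod_cast hn
  unfold TT
  apply (TT_summable (n+1)).tsum_le_of_sum_range_le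
  intro M
  have : ∑ m ∈ Finset.range M, 1 / ((n + 1 + m : ℕ):ℝ)^2 ≤ 1 / n - 1/(n+M:ℝ) := by
    induction M with
    | zero => simp
    | succ M ih =>
      rw [Finset.sum_range_succ]
      have : 1 / ((n + 1 + M : ℕ):ℝ)^2 ≤ 1/(n+M:ℝ) - 1/(n+(M+1:ℕ):ℝ) := by
        push_cast
        have hx : (0:ℝ) < n + M := by positivity
        rw [div_sub_div _ _ (by positivity) (by positivity), div_le_div_iff₀ (by positivity) (by positivity)]
        nlinarith
      linarith
  have h2 : 0 ≤ 1/(n+M:ℝ) := by positivity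
  linarith

lemma TT_sum (n : ℕ) (hn : 1 ≤ n) : ∑ j ∈ Finset.range n, TT (j+1) ≤ π^2/6 + 1 + Real.log n := by
  obtain ⟨m, rfl⟩ : ∃ m, n = m + 1 := ⟨n-1, by omega⟩
  rw [Finset.sum_range_succ', zero_add, TT_one]
  have h1 : ∑ j ∈ Finset.range m, TT (j+1+1) ≤ (harmonic m : ℝ) := by
    rw [harmonic]
    push_cast
    apply Finset.sum_le_sum
    intro j _
    have := TT_le (j+1) (by omega)
    push_cast at this
    simpa using this
  have h2 := harmonic_le_one_add_log m
  have h3 : Real.log m ≤ Real.log (m+1 : ℕ) := by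
    rcases Nat.eq_zero_or_pos m with rfl | h
    · simp
    · apply Real.log_le_log
      · exact_mod_cast h
      · push_cast; linarith
  linarith

end CB

namespace CB
open Filter Topology Set
open scoped ComplexConjugate

section haar
variable {ι : Type*} [Fintype ι] [DecidableEq ι]

instance compactU : CompactSpace (unitaryGroup ι ℂ) := by
  refine isCompact_iff_compactSpace (s := (unitaryGroup ι ℂ : Set (Matrix ι ι ℂ))).1 ?_
  have hK : IsCompact (Set.pi univ fun _ : ι => Set.pi univ fun _ : ι => Metric.closedBall (0:ℂ) 1) :=
    isCompact_univ_pi fun _ => isCompact_univ_pi fun _ => isCompact_closedBall _ _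
  refine IsCompact.of_isClosed_subset (s := (Set.pi univ fun _ : ι => Set.pi univ fun _ : ι => Metric.closedBall (0:ℂ) 1 : Set (Matrix ι ι ℂ))) hK ?_ ?_
  · have : (unitaryGroup ι ℂ : Set (Matrix ι ι ℂ)) = {A | star A * A = 1} := by
      ext A; exact mem_unitaryGroup_iff'
    rw [this]
    exact isClosed_eq (by fun_prop) continuous_const
  · intro A hA i _ j _
    simpa using entry_norm_bound_of_unitary hA i j

instance secondU : SecondCountableTopology (unitaryGroup ι ℂ) := by
  haveI : SecondCountableTopology (Matrix ι ι ℂ) := inferInstanceAs (SecondCountableTopology (ι → ι → ℂ))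
  exact TopologicalSpace.Subtype.secondCountableTopology _

lemma entry_cont (i j : ι) : Continuous (fun U : unitaryGroup ι ℂ => U.1 i j) :=
  continuous_subtype_val.matrix_elem i j

lemma unitary_rank_one (w : ι → ℂ) (c : ℂ) (h : c + conj c + c * conj c * (star w ⬝ᵥ w) = 0) :
    (1 + c • vecMulVec w (star w)) ∈ unitaryGroup ι ℂ := by
  rw [mem_unitaryGroup_iff', star_eq_conjTranspose, conjTranspose_add, conjTranspose_smul,
    conjTranspose_vecMulVec, star_star, conjTranspose_one]
  have h2 : vecMulVec w (star w) * vecMulVec w (star w) = (star w ⬝ᵥ w) • vecMulVec w (star w) := by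
    rw [vecMulVec_mul_vecMulVec, vecMulVec_smul]
  rw [add_mul, one_mul, mul_add, mul_one, smul_mul_smul_comm, h2, smul_smul, ← add_assoc,
    add_assoc _ (c • _), ← add_smul, add_assoc, ← add_smul]
  have : c + star c + star c * c * (star w ⬝ᵥ w) = 0 := by
    rw [← h, Complex.star_def]; ring
  rw [this, zero_smul, add_zero]

variable [MeasurableSpace (unitaryGroup ι ℂ)] [BorelSpace (unitaryGroup ι ℂ)]
  (μ : Measure (unitaryGroup ι ℂ)) [IsProbabilityMeasure μ] [μ.IsMulLeftInvariant]

/-- expectation functional -/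
noncomputable def EE (μ : Measure (unitaryGroup ι ℂ)) [IsProbabilityMeasure μ] :
    C(unitaryGroup ι ℂ, ℂ) →L[ℂ] ℂ :=
  LinearMap.mkContinuous
    { toFun := fun f => ∫ U, f U ∂μ
      map_add' := fun f g => by
        have hf : Integrable f μ := f.continuous.integrable_of_hasCompactSupport (HasCompactSupport.of_compactSpace _)
        have hg : Integrable g μ := g.continuous.integrable_of_hasCompactSupport (HasCompactSupport.of_compactSpace _)
        simpa using integral_add hf hg
      map_smul' := fun c f => by
        simp only [ContinuousMap.coe_smul, Pi.smul_apply, RingHom.id_apply]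
        exact integral_smul c _ } 1 (fun f => by
      have := norm_integral_le_of_norm_le_const (μ := μ) (f := f) (C := ‖f‖) (Eventually.of_forall fun U => f.norm_coe_le_norm U)
      simpa using this)

lemma EE_apply (f : C(unitaryGroup ι ℂ, ℂ)) : EE μ f = ∫ U, f U ∂μ := rfl

lemma EE_inv (f g : C(unitaryGroup ι ℂ, ℂ)) (D : unitaryGroup ι ℂ) (h : ∀ U, g U = f (D * U)) :
    EE μ g = EE μ f := by
  rw [EE_apply, EE_apply, ← integral_mul_left_eq_self f D]
  congr 1; funext U; exact h U

lemma EE_zero (f : C(unitaryGroup ι ℂ, ℂ)) (D : unitaryGroup ι ℂ) (z : ℂ) (hz : z ≠ 1)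
    (h : ∀ U, f (D * U) = z * f U) : EE μ f = 0 := by
  have h1 := EE_inv μ f (z • f) D (fun U => by simp [h])
  rw [map_smul, smul_eq_mul] at h1
  have : (z - 1) * EE μ f = 0 := by linear_combination h1
  rcases mul_eq_zero.1 this with h | h
  · exact absurd (sub_eq_zero.1 h) hz
  · exact h

/-- phase in the coordinate `i` -/
noncomputable def ph (i : ι) (z : ℂ) (hz : ‖z‖ = 1) : unitaryGroup ι ℂ :=
  ⟨diagonal (Function.update 1 i z), by
    rw [mem_unitaryGroup_iff', star_eq_conjTranspose, diagonal_conjTranspose, diagonal_mul_diagonal, ← diagonal_one]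
    congr 1
    funext j
    by_cases h : j = i
    · subst h; simp [Complex.conj_mul', hz]
    · simp [h]⟩

/-- entry functions -/
noncomputable def en (i j : ι) : C(unitaryGroup ι ℂ, ℂ) :=
  ⟨fun U => U.1 i j, entry_cont i j⟩

lemma en_apply (i j : ι) (U : unitaryGroup ι ℂ) : en i j U = U.1 i j := rfl

lemma en_ph_self (i j : ι) (z : ℂ) (hz : ‖z‖ = 1) (U : unitaryGroup ι ℂ) :
    en i j (ph i z hz * U) = z * en i j U := by
  simp [en_apply, ph]

lemma en_ph_ne (i l j : ι) (h : l ≠ i) (z : ℂ) (hz : ‖z‖ = 1) (U : unitaryGroup ι ℂ) :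
    en l j (ph i z hz * U) = en l j U := by
  simp [en_apply, ph, h]

lemma EE_orth (i j : ι) (a b : ℕ) (h : a ≠ b) : EE μ ((en i j)^a * (star (en i j))^b) = 0 := by
  have hd : (a:ℂ) - b ≠ 0 := sub_ne_zero.2 (by exact_mod_cast h)
  have hz : ‖Complex.exp ((π / ((a:ℝ) - b) : ℝ) * I)‖ = 1 := Complex.norm_exp_ofReal_mul_I _
  refine EE_zero μ _ (ph i _ hz) (-1) (by norm_num) ?_
  intro U
  simp only [ContinuousMap.mul_apply, ContinuousMap.pow_apply, ContinuousMap.star_apply, en_ph_self]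
  have : Complex.exp ((π / ((a:ℝ) - b) : ℝ) * I)^a * (star (Complex.exp ((π / ((a:ℝ) - b) : ℝ) * I)))^b = -1 := by
    have e : star (Complex.exp ((π / ((a:ℝ) - b) : ℝ) * I)) = Complex.exp (-((π / ((a:ℝ) - b) : ℝ) * I)) := by
      rw [Complex.star_def, ← Complex.exp_conj]; simp
    rw [e, ← Complex.exp_nat_mul, ← Complex.exp_nat_mul, ← Complex.exp_add, ← Complex.exp_pi_mul_I]
    congr 1
    push_cast
    field_simp
    ring
  rw [star_mul, mul_pow, mul_pow]
  linear_combination (en i j U)^a * (star (en i j U))^b * this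

lemma EE_rot (i l j : ι) (h : i ≠ l) (k : ℕ) :
    (k + 1) * EE μ ((en i j)^k * (star (en i j))^k * (en l j * star (en l j))) =
      EE μ ((en i j)^(k+1) * (star (en i j))^(k+1)) := by
  set p := en i j with hp
  set q := en l j with hq
  -- the curve
  set c : ℝ → ℂ := fun t => (Complex.exp (t * I) - 1) / 2 with hc
  set d : ℝ → ℂ := fun t => (Complex.exp (-(t * I)) - 1) / 2 with hd
  have hcd : ∀ t, conj (c t) = d t := by
    intro t
    simp only [hc, hd, map_div₀, map_sub, ← Complex.exp_conj]
    simp [Complex.conj_ofNat]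
  have hcd2 : ∀ t, c t + d t + c t * d t * 2 = 0 := by
    intro t
    simp only [hc, hd, Complex.exp_neg]
    have := Complex.exp_ne_zero (t * I)
    field_simp
    ring
  set w : ι → ℂ := Pi.single i 1 + Pi.single l 1 with hw
  have hww : star w ⬝ᵥ w = 2 := by
    have : star w = w := by
      funext x; simp only [hw, Pi.star_apply, Pi.add_apply, Pi.single_apply]; split_ifs <;> simp
    rw [this]
    simp [hw, h, h.symm]
    norm_num
  have hRu : ∀ t, (1 + c t • vecMulVec w (star w)) ∈ unitaryGroup ι ℂ := fun t =>
    unitary_rank_one w (c t) (by rw [hww, hcd]; exact hcd2 t)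
  have hws : star w = w := by
    funext x; simp only [hw, Pi.star_apply, Pi.add_apply, Pi.single_apply]; split_ifs <;> simp
  have hR1 : ∀ t U, p (⟨_, hRu t⟩ * U) = p U + c t * (p U + q U) := by
    intro t U
    simp only [hp, hq, en_apply, Submonoid.coe_mul, add_mul, one_mul, smul_mul, vecMulVec_mul, hws,
      Matrix.add_apply, Matrix.smul_apply, vecMulVec_apply, smul_eq_mul]
    simp [hw, add_vecMul, h]
  have hR2 : ∀ t U, q (⟨_, hRu t⟩ * U) = q U + c t * (p U + q U) := by
    intro t U
    simp only [hp, hq, en_apply, Submonoid.coe_mul, add_mul, one_mul, smul_mul, vecMulVec_mul, hws,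
      Matrix.add_apply, Matrix.smul_apply, vecMulVec_apply, smul_eq_mul]
    simp [hw, add_vecMul, h.symm]
  set F : ℝ → C(unitaryGroup ι ℂ, ℂ) := fun t =>
    (p + c t • (p + q))^(k+1) * ((star p + d t • star (p + q))^k * (star q + d t • star (p + q))) with hF
  have hconst : ∀ t, EE μ (F t) = EE μ (p^(k+1) * ((star p)^k * star q)) := by
    intro t
    refine EE_inv μ _ _ ⟨_, hRu t⟩ ?_
    intro U
    simp only [hF, ContinuousMap.mul_apply, ContinuousMap.pow_apply, ContinuousMap.star_apply, hR1, hR2,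
      ContinuousMap.add_apply, ContinuousMap.smul_apply, smul_eq_mul, star_add, star_mul]
    have : star (c t) = d t := hcd t
    rw [this]
    ring
  have hc0 : c 0 = 0 := by simp [hc]
  have hd0 : d 0 = 0 := by simp [hd]
  have hc' : HasDerivAt c (I/2) 0 := by
    have h1 : HasDerivAt (fun t : ℝ => (t:ℂ) * I) (1 * I) 0 := (Complex.ofRealCLM.hasDerivAt (x := 0)).mul_const I
    have := ((h1.cexp).sub_const 1).div_const 2
    simpa [hc] using this
  have hd' : HasDerivAt d (-I/2) 0 := by
    have h1 : HasDerivAt (fun t : ℝ => (t:ℂ) * I) (1 * I) 0 := (Complex.ofRealCLM.hasDerivAt (x := 0)).mul_const I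
    have := ((h1.neg.cexp).sub_const 1).div_const 2
    simpa [hd] using this
  have hP : HasDerivAt (fun t => p + c t • (p + q)) ((I/2) • (p+q)) 0 := by
    simpa using (hc'.smul_const (p+q)).const_add p
  have hQ1 : HasDerivAt (fun t => star p + d t • star (p + q)) ((-I/2) • star (p+q)) 0 := by
    simpa using (hd'.smul_const (star (p+q))).const_add (star p)
  have hQ2 : HasDerivAt (fun t => star q + d t • star (p + q)) ((-I/2) • star (p+q)) 0 := by
    simpa using (hd'.smul_const (star (p+q))).const_add (star q)
  have hFd := (hP.pow (k+1)).mul ((hQ1.pow k).mul hQ2)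
  have hEF : HasDerivAt (fun t => EE μ (F t)) _ 0 :=
    ((EE μ).restrictScalars ℝ).hasFDerivAt.comp_hasDerivAt (0:ℝ) hFd
  have hzero := hEF.unique (by
    have : (fun t => EE μ (F t)) = fun _ => EE μ (p^(k+1) * ((star p)^k * star q)) := funext hconst
    rw [this]; exact hasDerivAt_const _ _)
  simp only [hc0, hd0, zero_smul, add_zero, Nat.add_sub_cancel, Pi.mul_apply, Pi.pow_apply] at hzero
  -- vanishing terms
  have hm1 : ‖(-1:ℂ)‖ = 1 := by simp
  have hmI : ‖I‖ = 1 := by simp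
  have hv1 : ∀ a b : ℕ, EE μ (p^a * (star p)^b * star q) = 0 := by
    intro a b
    refine EE_zero μ _ (ph l (-1) hm1) (-1) (by norm_num) ?_
    intro U
    simp only [hp, hq, ContinuousMap.mul_apply, ContinuousMap.pow_apply, ContinuousMap.star_apply, en_ph_self, en_ph_ne l i j h]
    simp
  have hv2 : ∀ a b : ℕ, EE μ (p^a * (star p)^b * (star q * star q)) = 0 := by
    intro a b
    refine EE_zero μ _ (ph l I hmI) (-1) (by norm_num) ?_
    intro U
    simp only [hp, hq, ContinuousMap.mul_apply, ContinuousMap.pow_apply, ContinuousMap.star_apply, en_ph_self, en_ph_ne l i j h]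
    simp
    ring_nf
    simp
  have hexp : ((↑(k + 1) * p ^ k * (I / 2) • (p + q)) * (star p ^ k * star q) +
        p ^ (k + 1) * ((↑k * star p ^ (k - 1) * (-I / 2) • star (p + q)) * star q +
            star p ^ k * (-I / 2) • star (p + q)) : C(unitaryGroup ι ℂ, ℂ)) =
      ((k+1) * (I/2) : ℂ) • (p^(k+1) * star p ^ k * star q) +
      ((k+1) * (I/2) : ℂ) • (p^k * (star p)^k * (q * star q)) +
      (k * (-I/2) : ℂ) • (p^(k+1) * (star p)^(k-1+1) * star q) +
      (k * (-I/2) : ℂ) • (p^(k+1) * (star p)^(k-1) * (star q * star q)) +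
      (-I/2 : ℂ) • (p^(k+1) * star p ^(k+1)) + (-I/2 : ℂ) • (p^(k+1) * star p ^k * star q) := by
    ext U
    simp
    ring
  have hzero2 : EE μ ((↑(k + 1) * p ^ k * (I / 2) • (p + q)) * (star p ^ k * star q) +
        p ^ (k + 1) * ((↑k * star p ^ (k - 1) * (-I / 2) • star (p + q)) * star q +
            star p ^ k * (-I / 2) • star (p + q))) = 0 := by
    simpa using hzero
  rw [hexp] at hzero2
  simp only [map_add, map_smul, hv1, hv2, smul_eq_mul] at hzero2
  have hI : (I/2 : ℂ) ≠ 0 := by simp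
  apply mul_left_cancel₀ hI
  linear_combination hzero2

lemma EE_mom (i j : ι) (k : ℕ) : EE μ ((en i j)^k * (star (en i j))^k) = (mom (Fintype.card ι) k : ℂ) := by
  have hcard : 1 ≤ Fintype.card ι := Fintype.card_pos_iff.2 ⟨i⟩
  induction k with
  | zero =>
    simp only [pow_zero, mul_one, mom, EE_apply]
    simp
  | succ k ih =>
    have hsum : (en i j)^k * (star (en i j))^k =
        ∑ l, (en i j)^k * (star (en i j))^k * (en l j * star (en l j)) := by
      rw [← Finset.mul_sum]
      have : ∑ l, (en l j * star (en l j) : C(unitaryGroup ι ℂ, ℂ)) = 1 := by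
        ext U
        have h2 := congrFun (congrFun (mem_unitaryGroup_iff'.1 U.2) j) j
        rw [Matrix.mul_apply] at h2
        simp only [star_apply, one_apply_eq] at h2
        simp only [ContinuousMap.sum_apply, ContinuousMap.mul_apply, ContinuousMap.star_apply, en_apply, ContinuousMap.one_apply]
        rw [← h2]
        exact Finset.sum_congr rfl fun _ _ => mul_comm _ _
      rw [this, mul_one]
    set m := EE μ ((en i j)^(k+1) * (star (en i j))^(k+1)) with hm
    have hk : ((k:ℂ)+1) ≠ 0 := by exact_mod_cast k.succ_ne_zero
    have hterm : ∀ l, EE μ ((en i j)^k * (star (en i j))^k * (en l j * star (en l j))) =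
        if l = i then m else m / (k+1) := by
      intro l
      split_ifs with h
      · subst h
        rw [hm]; congr 1; ring
      · rw [eq_div_iff hk, hm, ← EE_rot μ i l j (Ne.symm h) k]; ring
    rw [hsum, map_sum] at ih
    simp only [hterm] at ih
    rw [Finset.sum_ite] at ih
    simp only [Finset.filter_eq', Finset.mem_univ, if_true, Finset.sum_const, Finset.card_singleton, one_smul] at ih
    rw [Finset.filter_ne', Finset.card_erase_of_mem (Finset.mem_univ _), Finset.card_univ, nsmul_eq_mul,
      Nat.cast_sub hcard] at ih
    rw [mom]
    push_cast at ih ⊢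
    rw [← ih]
    have h3 : (Fintype.card ι : ℂ) + k ≠ 0 := by exact_mod_cast (by omega : Fintype.card ι + k ≠ 0)
    field_simp
    ring

/-- second moments of polynomials in an entry -/
lemma lint_poly (i j : ι) (b : ℕ → ℂ) (K : ℕ) :
    ∫⁻ U : unitaryGroup ι ℂ, ENNReal.ofReal (‖∑ k ∈ Finset.range K, b k * (U.1 i j)^k‖^2) ∂μ =
      ENNReal.ofReal (∑ k ∈ Finset.range K, ‖b k‖^2 * mom (Fintype.card ι) k) := by
  set P : C(unitaryGroup ι ℂ, ℂ) := ∑ k ∈ Finset.range K, b k • (en i j)^k with hP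
  have hPa : ∀ U, P U = ∑ k ∈ Finset.range K, b k * (U.1 i j)^k := by
    intro U; simp [hP, ContinuousMap.sum_apply, en_apply]
  have hE : EE μ (P * star P) = ((∑ k ∈ Finset.range K, ‖b k‖^2 * mom (Fintype.card ι) k : ℝ) : ℂ) := by
    have : P * star P = ∑ k ∈ Finset.range K, ∑ l ∈ Finset.range K,
        (b k * star (b l)) • ((en i j)^k * (star (en i j))^l) := by
      rw [hP, star_sum, Finset.sum_mul_sum]
      refine Finset.sum_congr rfl fun k _ => Finset.sum_congr rfl fun l _ => ?_
      rw [star_smul, star_pow, smul_mul_smul_comm]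
    rw [this, map_sum]
    push_cast
    refine Finset.sum_congr rfl fun k hk => ?_
    rw [map_sum, Finset.sum_eq_single k]
    · rw [map_smul, EE_mom, smul_eq_mul]
      congr 1
      simp [Complex.mul_conj']
    · intro l _ hl
      rw [map_smul, EE_orth μ i j k l (Ne.symm hl), smul_zero]
    · intro h; exact absurd hk h
  have hPint : ∫ U : unitaryGroup ι ℂ, ‖P U‖^2 ∂μ = ∑ k ∈ Finset.range K, ‖b k‖^2 * mom (Fintype.card ι) k := by
    rw [EE_apply] at hE
    have h2 : ∀ U, (P * star P) U = ((‖P U‖^2 : ℝ) : ℂ) := by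
      intro U; simp [Complex.mul_conj']
    simp only [h2] at hE
    have h3 := integral_ofReal (𝕜 := ℂ) (μ := μ) (f := fun U => ‖P U‖^2)
    exact Complex.ofReal_injective (h3.symm.trans hE)
  rw [← hPint, ofReal_integral_eq_lintegral_ofReal]
  · simp only [hPa]
  · exact Continuous.integrable_of_hasCompactSupport (by fun_prop) (HasCompactSupport.of_compactSpace _)
  · exact Eventually.of_forall fun U => by positivity

lemma fatou {α : Type*} [MeasurableSpace α] (ν : Measure α) (f : ℕ → α → ENNReal) (g : α → ENNReal)
    (hf : ∀ k, Measurable (f k)) (hl : ∀ x, Tendsto (fun k => f k x) atTop (𝓝 (g x))) (B : ENNReal)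
    (hB : ∀ k, ∫⁻ x, f k x ∂ν ≤ B) : ∫⁻ x, g x ∂ν ≤ B := by
  have h1 : ∀ x, g x = liminf (fun k => f k x) atTop := fun x => (hl x).liminf_eq.symm
  simp only [h1]
  refine (lintegral_liminf_le hf).trans ?_
  refine liminf_le_of_le (by isBoundedDefault) ?_
  intro b hb
  obtain ⟨k, hk⟩ := hb.exists
  exact hk.trans (hB k)

lemma lint_entry (i j : ι) (s : ℝ) :
    ∫⁻ U : unitaryGroup ι ℂ, ENNReal.ofReal (Real.exp (s * (Complex.log (1 - U.1 i j)).im)) ∂μ ≤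
      ENNReal.ofReal (Real.exp ((s/2)^2 * TT (Fintype.card ι))) := by
  have hcard : 1 ≤ Fintype.card ι := Fintype.card_pos_iff.2 ⟨i⟩
  have hb : ∀ U : unitaryGroup ι ℂ, ‖U.1 i j‖ ≤ 1 := fun U => entry_norm_bound_of_unitary U.2 i j
  have hlt : ∀ r : ℝ, 0 ≤ r → r < 1 → ∀ U : unitaryGroup ι ℂ, ‖(r:ℂ) * U.1 i j‖ < 1 := by
    intro r h0 h1 U
    rw [norm_mul, Complex.norm_of_nonneg h0]
    nlinarith [hb U, norm_nonneg (U.1 i j)]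
  have hslit : ∀ z : ℂ, ‖z‖ < 1 → 1 - z ∈ slitPlane := by
    intro z hz
    rw [Complex.mem_slitPlane_iff]; left
    have := Complex.re_le_norm z
    simp; linarith
  -- r < 1
  have hr : ∀ r : ℝ, 0 ≤ r → r < 1 →
      ∫⁻ U : unitaryGroup ι ℂ, ENNReal.ofReal (Real.exp (s * (Complex.log (1 - r * U.1 i j)).im)) ∂μ ≤
      ENNReal.ofReal (Real.exp ((s/2)^2 * TT (Fintype.card ι))) := by
    intro r h0 h1
    refine fatou μ (fun K U => ENNReal.ofReal (‖∑ k ∈ Finset.range K, (cf (s/2) k * r^k) * (U.1 i j)^k‖^2)) _ ?_ ?_ _ ?_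
    · intro K
      apply Measurable.ennreal_ofReal
      apply Continuous.measurable
      exact (continuous_finsetSum _ fun k _ => continuous_const.mul ((entry_cont i j).pow k)).norm.pow 2
    · intro U
      apply ENNReal.tendsto_ofReal
      have h3 := slitPlane_ne_zero (hslit _ (hlt r h0 h1 U))
      rw [exp_im_log s _ h3]
      have h4 := (cf_hasSum (s/2) _ (hlt r h0 h1 U)).tendsto_sum_nat
      refine (Tendsto.pow (Tendsto.norm ?_) 2)
      refine h4.congr fun K => Finset.sum_congr rfl fun k _ => ?_
      rw [mul_pow]; ring
    · intro K
      rw [lint_poly]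
      apply ENNReal.ofReal_le_ofReal
      refine le_trans ?_ (SS_le (s/2) (Fintype.card ι) hcard K)
      unfold SS
      refine Finset.sum_le_sum fun k _ => ?_
      refine mul_le_mul_of_nonneg_right ?_ (mom_nonneg _ _)
      rw [norm_mul, mul_pow]
      have : ‖(r:ℂ)^k‖ ≤ 1 := by
        rw [norm_pow, Complex.norm_of_nonneg h0]; exact pow_le_one₀ h0 h1.le
      have h5 : ‖(r:ℂ)^k‖^2 ≤ 1 := pow_le_one₀ (norm_nonneg _) this
      nlinarith [sq_nonneg ‖cf (s/2) k‖]
  set r : ℕ → ℝ := fun m => 1 - 1/((m:ℝ)+1) with hrdef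
  have hr0 : ∀ m, 0 ≤ r m := by
    intro m
    have : 1/((m:ℝ)+1) ≤ 1 := by rw [div_le_one (by positivity)]; linarith [Nat.cast_nonneg (α := ℝ) m]
    simp only [hrdef]; linarith
  have hr1 : ∀ m, r m < 1 := by
    intro m
    have : 0 < 1/((m:ℝ)+1) := by positivity
    simp only [hrdef]; linarith
  have hrt : Tendsto r atTop (𝓝 1) := by
    have := (tendsto_one_div_add_atTop_nhds_zero_nat (𝕜 := ℝ)).const_sub 1
    simpa [hrdef] using this
  refine fatou μ (fun m U => ENNReal.ofReal (Real.exp (s * (Complex.log (1 - r m * U.1 i j)).im))) _ ?_ ?_ _ ?_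
  · intro m
    apply Measurable.ennreal_ofReal
    apply Continuous.measurable
    refine Real.continuous_exp.comp (continuous_const.mul (Complex.continuous_im.comp ?_))
    refine Continuous.clog (continuous_const.sub (continuous_const.mul (entry_cont i j))) ?_
    intro U
    exact hslit _ (hlt _ (hr0 m) (hr1 m) U)
  · intro U
    apply ENNReal.tendsto_ofReal
    refine (Real.continuous_exp.tendsto _).comp (Tendsto.const_mul s ?_)
    by_cases h1 : U.1 i j = 1
    · have : ∀ m, (Complex.log (1 - r m * U.1 i j)).im = 0 := by
        intro m
        rw [h1, mul_one, ← Complex.ofReal_one, ← Complex.ofReal_sub, ← Complex.ofReal_log (by linarith [hr1 m])]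
        simp
      simp only [this]
      rw [h1]; simp
    · refine (Complex.continuous_im.tendsto _).comp ?_
      refine Tendsto.clog ?_ ?_
      · have : Tendsto (fun m => (r m : ℂ)) atTop (𝓝 1) := by
          have := (Complex.continuous_ofReal.tendsto 1).comp hrt
          simpa [Function.comp_def] using this
        simpa using (this.mul_const (U.1 i j)).const_sub 1
      · have := slit_of 1 zero_le_one le_rfl _ (hb U) h1
        simpa using this
  · intro m
    exact hr _ (hr0 m) (hr1 m)

end haar
end CB
namespace CB
open Filter Topology Set
open scoped ComplexConjugate

section step
variable {ι κ : Type*} [Fintype ι] [DecidableEq ι] [Fintype κ] [DecidableEq κ]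

open Classical in
/-- truncated exponential of the argument -/
noncomputable def FF (s : ℝ) (A : Matrix ι ι ℂ) : ENNReal :=
  if det (1 - A) ≠ 0 then ENNReal.ofReal (Real.exp (s * (Lc 1 A).im)) else 0

lemma FF_reindex (s : ℝ) (e : ι ≃ κ) (A : Matrix ι ι ℂ) : FF s (reindex e e A) = FF s A := by
  have h1 : det (1 - reindex e e A) = det (1 - A) := by
    rw [← Matrix.det_reindex_self e (1 - A)]
    congr 1
    simp [reindex_apply, submatrix_sub]
  have h2 : Lc 1 (reindex e e A) = Lc 1 A := by
    unfold Lc; rw [charpoly_reindex]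
  unfold FF
  rw [h1, h2]

lemma FF_meas (s : ℝ) [MeasurableSpace (unitaryGroup ι ℂ)] [BorelSpace (unitaryGroup ι ℂ)] :
    Measurable (fun U : unitaryGroup ι ℂ => FF s U.1) := by
  classical
  have hc : Continuous (fun U : unitaryGroup ι ℂ => det (1 - U.1)) :=
    (continuous_const.sub continuous_subtype_val).matrix_det
  have ho : IsOpen {U : unitaryGroup ι ℂ | det (1 - U.1) ≠ 0} := isOpen_ne_fun hc continuous_const
  have hcont : ContinuousOn (fun U : unitaryGroup ι ℂ => ENNReal.ofReal (Real.exp (s * (Lc 1 U.1).im)))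
      {U : unitaryGroup ι ℂ | det (1 - U.1) ≠ 0} := by
    rw [continuousOn_iff_continuous_domRestrict]
    have h1 := continuous_lc (fun U : {U : unitaryGroup ι ℂ | det (1 - U.1) ≠ 0} => U.1.1)
      (continuous_subtype_val.comp continuous_subtype_val) (fun U => good_unitary U.1.2 U.2)
    exact ENNReal.continuous_ofReal.comp (Real.continuous_exp.comp
      (continuous_const.mul (Complex.continuous_im.comp h1)))
  have := hcont.measurable_piecewise (g := fun _ => (0:ENNReal)) continuousOn_const ho.measurableSet
  convert this using 1
  ext U
  simp only [FF, Set.piecewise]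
  congr

lemma null_set [MeasurableSpace (unitaryGroup ι ℂ)] [BorelSpace (unitaryGroup ι ℂ)]
    (μ : Measure (unitaryGroup ι ℂ)) [IsProbabilityMeasure μ] [μ.IsMulLeftInvariant] :
    μ {U | det (1 - U.1) = 0} = 0 := by
  by_contra hne
  have hz : ∃ z : ℕ → Circle, Function.Injective z := by
    refine ⟨fun k => Circle.exp (1 / ((k:ℝ)+1)), fun a b hab => ?_⟩
    have hp := Real.pi_gt_three
    have hb : ∀ k : ℕ, -π < 1 / ((k:ℝ)+1) ∧ 1 / ((k:ℝ)+1) ≤ π := by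
      intro k
      have h1 : (0:ℝ) < 1 / ((k:ℝ)+1) := by positivity
      have h2 : 1 / ((k:ℝ)+1) ≤ 1 := by
        rw [div_le_one (by positivity)]; linarith [Nat.cast_nonneg (α := ℝ) k]
      constructor <;> linarith
    have h3 : Complex.arg (Circle.exp (1 / ((a:ℝ)+1))) = Complex.arg (Circle.exp (1 / ((b:ℝ)+1))) := by
      have : Circle.exp (1 / ((a:ℝ)+1)) = Circle.exp (1 / ((b:ℝ)+1)) := hab
      rw [this]
    rw [Circle.arg_exp (hb a).1 (hb a).2, Circle.arg_exp (hb b).1 (hb b).2] at h3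
    field_simp at h3
    have h4 : (a:ℝ) = b := by linarith
    exact_mod_cast h4
  obtain ⟨z, hz⟩ := hz
  let D : ℕ → unitaryGroup ι ℂ := fun k => ⟨(z k : ℂ) • 1, by
    rw [mem_unitaryGroup_iff', star_smul, star_one, smul_mul_smul_comm, one_mul]
    have : star (z k : ℂ) * z k = 1 := by
      rw [Complex.star_def, Complex.conj_mul', Circle.norm_coe]; simp
    rw [this, one_smul]⟩
  have hD : ∀ k (U : unitaryGroup ι ℂ), (D k * U).1 = (z k : ℂ) • U.1 := by
    intro k U
    simp [D]
  have hc : Continuous (fun U : unitaryGroup ι ℂ => det (1 - U.1)) :=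
    (continuous_const.sub continuous_subtype_val).matrix_det
  have hm : MeasurableSet {U : unitaryGroup ι ℂ | det (1 - U.1) = 0} :=
    (isClosed_eq hc continuous_const).measurableSet
  obtain ⟨t, ht, htu⟩ := bergelson' (μ := μ) (s := fun k => (fun U => D k * U) ⁻¹' {U | det (1 - U.1) = 0})
    (r := μ {U | det (1 - U.1) = 0}) (fun k => (measurable_const_mul _) hm) hne
    (fun k => (measure_preimage_mul μ (D k) _).ge)
  obtain ⟨u, hut, hucard⟩ := ht.exists_subset_card_eq (Fintype.card ι + 1)
  have hpos := htu hut u.finite_toSet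
  obtain ⟨U, hU⟩ := nonempty_of_measure_ne_zero hpos.ne'
  have hU' : ∀ k ∈ u, det (1 - (z k : ℂ) • U.1) = 0 := by
    intro k hk
    have := mem_iInter₂.1 hU k hk
    simpa [← hD] using this
  have hroot : ∀ k ∈ u, ((z k : ℂ))⁻¹ ∈ U.1.charpoly.roots.toFinset := by
    intro k hk
    have h1 := hU' k hk
    rw [det_one_sub_smul', Multiset.prod_eq_zero_iff, Multiset.mem_map] at h1
    obtain ⟨l, hl, hl0⟩ := h1
    have : (z k : ℂ)⁻¹ = l := by
      rw [inv_eq_iff_eq_inv]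
      exact eq_inv_of_mul_eq_one_left (by linear_combination -hl0)
    rw [this]; exact Multiset.mem_toFinset.2 hl
  have h1 := Finset.card_le_card_of_injOn (fun k => ((z k : ℂ))⁻¹) hroot (by
    intro a _ b _ hab
    exact hz (Circle.ext (inv_injective hab)))
  have h2 := Multiset.toFinset_card_le U.1.charpoly.roots
  have h3 := Polynomial.card_roots' U.1.charpoly
  rw [Matrix.charpoly_natDegree_eq_dim] at h3
  omega

lemma blk_mem {V : Matrix κ κ ℂ} (hV : V ∈ unitaryGroup κ ℂ) :
    (fromBlocks 1 0 0 V : Matrix (Unit ⊕ κ) (Unit ⊕ κ) ℂ) ∈ unitaryGroup (Unit ⊕ κ) ℂ := by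
  rw [mem_unitaryGroup_iff', star_eq_conjTranspose, fromBlocks_conjTranspose, fromBlocks_multiply]
  rw [mem_unitaryGroup_iff', star_eq_conjTranspose] at hV
  simp [hV]

lemma decomp {U : Matrix (Unit ⊕ κ) (Unit ⊕ κ) ℂ} (hU : U ∈ unitaryGroup (Unit ⊕ κ) ℂ)
    (h1 : U (.inl ()) (.inl ()) ≠ 1) :
    ∃ (w v : Unit ⊕ κ → ℂ) (H : Matrix (Unit ⊕ κ) (Unit ⊕ κ) ℂ) (W : Matrix κ κ ℂ),
      H = 1 + vecMulVec w v ∧ H ∈ unitaryGroup (Unit ⊕ κ) ℂ ∧ W ∈ unitaryGroup κ ℂ ∧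
      H (.inl ()) (.inl ()) = U (.inl ()) (.inl ()) ∧ U = H * fromBlocks 1 0 0 W := by
  set e : Unit ⊕ κ → ℂ := Pi.single (.inl ()) 1 with he
  set u := U *ᵥ e with hu
  set a := U (.inl ()) (.inl ()) with ha
  have hu1 : u (.inl ()) = a := by simp [hu, he, ha]
  have huu : star u ⬝ᵥ u = 1 := by
    rw [hu, star_mulVec, ← dotProduct_mulVec, mulVec_mulVec]
    rw [mem_unitaryGroup_iff', star_eq_conjTranspose] at hU
    rw [hU, one_mulVec]; simp [he]
  have hse : star e = e := by
    rw [he]; ext i; by_cases h : i = .inl () <;> simp [h, Pi.single_apply]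
  have heu : e ⬝ᵥ u = a := by rw [he, single_one_dotProduct, hu1]
  have hue : star u ⬝ᵥ e = conj a := by rw [he, dotProduct_single_one, Pi.star_apply, hu1]; rfl
  have hee : e ⬝ᵥ e = 1 := by simp [he]
  set w := u - e with hw
  have hww : star w ⬝ᵥ w = 2 - a - conj a := by
    rw [hw, star_sub, hse, sub_dotProduct, dotProduct_sub, dotProduct_sub, huu, hue, heu, hee]; ring
  have hwe : star w ⬝ᵥ e = conj a - 1 := by
    rw [hw, star_sub, hse, sub_dotProduct, hue, hee]
  have ha1 : 1 - a ≠ 0 := sub_ne_zero.2 (Ne.symm h1)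
  have ha2 : 1 - conj a ≠ 0 := by
    intro h; apply ha1
    have := congrArg conj h
    simpa using this
  set c : ℂ := -(1 - conj a)⁻¹ with hc
  have hcc : conj c = -(1 - a)⁻¹ := by simp [hc]
  set H := 1 + c • vecMulVec w (star w) with hH
  have hHu : H ∈ unitaryGroup (Unit ⊕ κ) ℂ := by
    apply unitary_rank_one
    rw [hww, hcc, hc]; field_simp; ring
  have hHe : H *ᵥ e = u := by
    rw [hH, add_mulVec, one_mulVec, smul_mulVec, vecMulVec_mulVec, hwe]
    have : c * (conj a - 1) = 1 := by rw [hc]; field_simp; ring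
    ext i
    have : c * (w i * (conj a - 1)) = w i := by linear_combination w i * this
    have hwi : w i = u i - e i := rfl
    rw [hwi] at this
    simp [hw]
    linear_combination this
  have hH11 : H (.inl ()) (.inl ()) = a := by
    rw [← hu1, ← hHe]; simp [he]
  set M := star H * U with hM
  have hMu : M ∈ unitaryGroup (Unit ⊕ κ) ℂ := mul_mem (Unitary.star_mem hHu) hU
  have hHM : H * M = U := by
    rw [hM, ← mul_assoc, mem_unitaryGroup_iff.1 hHu, one_mul]
  have hMe : M *ᵥ e = e := by
    rw [hM, ← mulVec_mulVec, ← hu, ← hHe, mulVec_mulVec, mem_unitaryGroup_iff'.1 hHu, one_mulVec]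
  have hMse : star M *ᵥ e = e := by
    conv_lhs => rw [← hMe]
    rw [mulVec_mulVec, mem_unitaryGroup_iff'.1 hMu, one_mulVec]
  have hcol : ∀ i, M i (.inl ()) = e i := by
    intro i; rw [← hMe]; simp [he]
  have hrow : ∀ i, M (.inl ()) i = e i := by
    intro i
    have h := congrFun hMse i
    rw [← hse]
    simp only [Pi.star_apply]
    rw [← h]
    simp [he, star_apply]
  have hMb : M = fromBlocks 1 0 0 M.toBlocks₂₂ := by
    ext i j
    rcases i with i | i <;> rcases j with j | j
    · simp [hcol, he]
    · simp [hrow, he]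
    · simp [hcol, he]
    · simp [toBlocks₂₂]
  refine ⟨c • w, star w, H, M.toBlocks₂₂, ?_, hHu, ?_, hH11, ?_⟩
  · rw [hH, smul_vecMulVec]
  · have h := mem_unitaryGroup_iff'.1 hMu
    rw [hMb, star_eq_conjTranspose, fromBlocks_conjTranspose, fromBlocks_multiply, ← fromBlocks_one] at h
    have h2 := (fromBlocks_inj.1 h).2.2.2
    rw [mem_unitaryGroup_iff', star_eq_conjTranspose]
    simpa using h2
  · rw [← hMb, hHM]

lemma step_pt (s : ℝ) {U : Matrix (Unit ⊕ κ) (Unit ⊕ κ) ℂ} (hU : U ∈ unitaryGroup (Unit ⊕ κ) ℂ) :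
    ∃ W : unitaryGroup κ ℂ, ∀ V : unitaryGroup κ ℂ, FF s (U * fromBlocks 1 0 0 V.1) ≤
      ENNReal.ofReal (Real.exp (s * (Complex.log (1 - U (.inl ()) (.inl ()))).im)) * FF s (W * V).1 := by
  classical
  by_cases h1 : U (.inl ()) (.inl ()) = 1
  · refine ⟨1, fun V => ?_⟩
    have hd : det (1 - U * fromBlocks 1 0 0 V.1) = 0 := by
      set e : Unit ⊕ κ → ℂ := Pi.single (.inl ()) 1 with he
      have hcol : U *ᵥ e = e := by
        have hs : ∑ i, ‖(U *ᵥ e) i‖^2 = 1 := by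
          rw [unitary_norm hU]; simp [he]
        rw [Fintype.sum_sum_type] at hs
        have h11 : (U *ᵥ e) (.inl ()) = 1 := by simp [he, h1]
        simp only [Finset.univ_unique, Finset.sum_singleton] at hs
        rw [show (default : Unit) = () from rfl, h11] at hs
        simp only [norm_one, one_pow, add_eq_left] at hs
        rw [Finset.sum_eq_zero_iff_of_nonneg (fun _ _ => by positivity)] at hs
        ext i
        rcases i with i | i
        · rw [h11]; simp [he]
        · have := hs i (Finset.mem_univ _)
          simp only [ne_eq, OfNat.ofNat_ne_zero, not_false_eq_true, pow_eq_zero_iff, norm_eq_zero] at this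
          rw [this]; simp [he]
      have hbe : (fromBlocks 1 0 0 V.1 : Matrix (Unit ⊕ κ) (Unit ⊕ κ) ℂ) *ᵥ e = e := by
        ext i
        rcases i with i | i <;> simp [he]
      rw [← Matrix.exists_mulVec_eq_zero_iff]
      refine ⟨e, ?_, ?_⟩
      · intro h
        have := congrFun h (.inl ())
        simp [he] at this
      · rw [sub_mulVec, one_mulVec, ← mulVec_mulVec, hbe, hcol, sub_self]
    rw [FF, if_neg (by simpa using hd)]
    exact zero_le
  · obtain ⟨w, v, H, W, hH, hHu, hW, h11, hUW⟩ := decomp hU h1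
    refine ⟨⟨W, hW⟩, fun V => ?_⟩
    have hmul : U * fromBlocks 1 0 0 V.1 = H * fromBlocks 1 0 0 (W * V.1) := by
      rw [hUW, mul_assoc, fromBlocks_multiply]; simp
    have hWV : W * V.1 ∈ unitaryGroup κ ℂ := mul_mem hW V.2
    rw [hmul]
    have hcoe : ((⟨W, hW⟩ * V : unitaryGroup κ ℂ) : Matrix κ κ ℂ) = W * V.1 := rfl
    rw [hcoe]
    rw [← h11] at h1 ⊢
    by_cases hd : det (1 - W * V.1) = 0
    · rw [FF, if_neg]
      · exact zero_le
      · rw [det_block w v hH h1, hd]; simp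
    · have hd2 : det (1 - H * fromBlocks 1 0 0 (W * V.1)) ≠ 0 := by
        rw [det_block w v hH h1]
        exact mul_ne_zero (sub_ne_zero.2 (Ne.symm h1)) hd
      rw [FF, if_pos hd2, FF, if_pos hd, lc_block w v hH hHu h1 _ hWV hd,
        ← ENNReal.ofReal_mul (Real.exp_pos _).le, ← Real.exp_add, Complex.add_im, mul_add]

end step
end CB
namespace CB
open Filter Topology Set
open scoped ComplexConjugate

section integ
variable {ι κ : Type*} [Fintype ι] [DecidableEq ι] [Fintype κ] [DecidableEq κ]

lemma reindex_mem (e : κ ≃ ι) {V : Matrix κ κ ℂ} (hV : V ∈ unitaryGroup κ ℂ) :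
    reindex e e V ∈ unitaryGroup ι ℂ := by
  rw [mem_unitaryGroup_iff', star_eq_conjTranspose] at hV ⊢
  rw [conjTranspose_reindex, reindex_apply, reindex_apply, submatrix_mul_equiv, hV, submatrix_one_equiv]

lemma right_inv [MeasurableSpace (unitaryGroup ι ℂ)] [BorelSpace (unitaryGroup ι ℂ)]
    (μ : Measure (unitaryGroup ι ℂ)) [IsProbabilityMeasure μ] [μ.IsHaarMeasure] :
    μ.IsMulRightInvariant := by
  refine ⟨fun g => ?_⟩
  have : IsProbabilityMeasure (Measure.map (· * g) μ) :=
    Measure.isProbabilityMeasure_map (measurable_mul_const g).aemeasurable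
  exact Measure.isHaarMeasure_eq_of_isProbabilityMeasure _ _

lemma lint_step (e : Unit ⊕ κ ≃ ι) (s : ℝ)
    [MeasurableSpace (unitaryGroup ι ℂ)] [BorelSpace (unitaryGroup ι ℂ)]
    [MeasurableSpace (unitaryGroup κ ℂ)] [BorelSpace (unitaryGroup κ ℂ)]
    (μ : Measure (unitaryGroup ι ℂ)) [IsProbabilityMeasure μ] [μ.IsHaarMeasure]
    (ν : Measure (unitaryGroup κ ℂ)) [IsProbabilityMeasure ν] [ν.IsHaarMeasure] :
    ∫⁻ U, FF s U.1 ∂μ ≤ ENNReal.ofReal (Real.exp ((s/2)^2 * TT (Fintype.card ι))) * ∫⁻ V, FF s V.1 ∂ν := by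
  have hR := right_inv μ
  let emb : unitaryGroup κ ℂ → unitaryGroup ι ℂ := fun V =>
    ⟨reindex e e (fromBlocks 1 0 0 V.1), reindex_mem e (blk_mem V.2)⟩
  have hemb : Continuous emb := by
    refine Continuous.subtype_mk ?_ _
    exact (Continuous.matrix_fromBlocks continuous_const continuous_const continuous_const
      continuous_subtype_val).matrix_reindex e e
  have hmeas : Measurable (fun p : unitaryGroup κ ℂ × unitaryGroup ι ℂ => FF s (p.2 * emb p.1).1) :=
    (FF_meas s).comp (continuous_snd.mul (hemb.comp continuous_fst)).measurable
  have hpt : ∀ U : unitaryGroup ι ℂ, ∫⁻ V, FF s (U * emb V).1 ∂ν ≤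
      ENNReal.ofReal (Real.exp (s * (Complex.log (1 - U.1 (e (.inl ())) (e (.inl ())))).im)) *
        ∫⁻ V, FF s V.1 ∂ν := by
    intro U
    obtain ⟨W, hW⟩ := step_pt s (reindex_mem e.symm U.2)
    have h1 : ∀ V, FF s (U * emb V).1 ≤
        ENNReal.ofReal (Real.exp (s * (Complex.log (1 - U.1 (e (.inl ())) (e (.inl ())))).im)) * FF s (W * V).1 := by
      intro V
      have h2 : (U * emb V).1 = reindex e e (reindex e.symm e.symm U.1 * fromBlocks 1 0 0 V.1) := by
        change U.1 * reindex e e (fromBlocks 1 0 0 V.1) = _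
        simp only [reindex_apply, Equiv.symm_symm]
        rw [← submatrix_mul_equiv _ _ _ e.symm _]
        simp
      rw [h2, FF_reindex]
      exact hW V
    calc _ ≤ ∫⁻ V, ENNReal.ofReal (Real.exp (s * (Complex.log (1 - U.1 (e (.inl ())) (e (.inl ())))).im)) * FF s (W * V).1 ∂ν :=
          lintegral_mono h1
      _ = _ := by
          rw [lintegral_const_mul' _ _ ENNReal.ofReal_ne_top]
          rw [lintegral_mul_left_eq_self (μ := ν) (fun V => FF s V.1) W]
  calc ∫⁻ U, FF s U.1 ∂μ = ∫⁻ V, ∫⁻ U, FF s (U * emb V).1 ∂μ ∂ν := by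
        have : ∀ V, ∫⁻ U, FF s (U * emb V).1 ∂μ = ∫⁻ U, FF s U.1 ∂μ := fun V =>
          lintegral_mul_right_eq_self (μ := μ) (fun U => FF s U.1) (emb V)
        simp_rw [this]; simp
    _ = ∫⁻ U, ∫⁻ V, FF s (U * emb V).1 ∂ν ∂μ := lintegral_lintegral_swap hmeas.aemeasurable
    _ ≤ ∫⁻ U, ENNReal.ofReal (Real.exp (s * (Complex.log (1 - U.1 (e (.inl ())) (e (.inl ())))).im)) *
        ∫⁻ V, FF s V.1 ∂ν ∂μ := lintegral_mono hpt
    _ = (∫⁻ U, ENNReal.ofReal (Real.exp (s * (Complex.log (1 - U.1 (e (.inl ())) (e (.inl ())))).im)) ∂μ) *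
        ∫⁻ V, FF s V.1 ∂ν := by
        refine lintegral_mul_const _ ?_
        apply Measurable.ennreal_ofReal
        apply Real.measurable_exp.comp
        apply Measurable.const_mul
        apply Complex.measurable_im.comp
        apply Complex.measurable_log.comp
        exact (continuous_const.sub (entry_cont _ _)).measurable
    _ ≤ _ := mul_le_mul_left (lint_entry μ _ _ s) _

lemma lint_all (s : ℝ) (n : ℕ) : ∀ (_ : MeasurableSpace (unitaryGroup (Fin n) ℂ))
    (_ : BorelSpace (unitaryGroup (Fin n) ℂ)) (μ : Measure (unitaryGroup (Fin n) ℂ)),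
    IsProbabilityMeasure μ → μ.IsHaarMeasure →
    ∫⁻ U, FF s U.1 ∂μ ≤ ENNReal.ofReal (Real.exp ((s/2)^2 * ∑ j ∈ Finset.range n, TT (j+1))) := by
  induction n with
  | zero =>
    intro _ _ μ _ _
    have : ∀ U : unitaryGroup (Fin 0) ℂ, FF s U.1 = 1 := by
      intro U
      simp [FF, Lc]
    simp [this]
  | succ n ih =>
    intro _ _ μ hμ hH
    letI : MeasurableSpace (unitaryGroup (Fin n) ℂ) := borel _
    haveI : BorelSpace (unitaryGroup (Fin n) ℂ) := ⟨rfl⟩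
    let ν : Measure (unitaryGroup (Fin n) ℂ) := Measure.haarMeasure ⊤
    haveI hν : IsProbabilityMeasure ν := ⟨by
      have := Measure.haarMeasure_self (G := unitaryGroup (Fin n) ℂ) (K₀ := ⊤)
      simpa using this⟩
    have h1 := lint_step (ι := Fin (n+1)) (κ := Fin n)
      ((Equiv.sumComm _ _).trans ((Equiv.sumCongr (Equiv.refl _) (Equiv.equivPUnit (Fin 1)).symm).trans finSumFinEquiv)) s μ ν
    refine h1.trans ?_
    have h2 := ih inferInstance inferInstance ν inferInstance inferInstance
    rw [Finset.sum_range_succ, mul_add, Real.exp_add, mul_comm (Real.exp _), ENNReal.ofReal_mul (Real.exp_pos _).le,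
      Fintype.card_fin]
    exact mul_le_mul_right h2 _

lemma tail (n : ℕ) (hn : 1 ≤ n) [MeasurableSpace (unitaryGroup (Fin n) ℂ)]
    [BorelSpace (unitaryGroup (Fin n) ℂ)] (μ : Measure (unitaryGroup (Fin n) ℂ))
    [IsProbabilityMeasure μ] [μ.IsHaarMeasure] (x : ℝ) (hx : 0 ≤ x) (σ : ℝ) (hσ : σ^2 = 1) :
    μ {U | det (1 - U.1) ≠ 0 ∧ x ≤ σ * (Lc 1 U.1).im} ≤
      ENNReal.ofReal (Real.exp (-x ^ 2 / (π ^ 2 / 6 + 1 + Real.log n))) := by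
  set K := π ^ 2 / 6 + 1 + Real.log n with hK
  have hKpos : 0 < K := by
    have := Real.log_nonneg (x := n) (by exact_mod_cast hn)
    positivity
  set t := 2 * x / K with ht
  have ht0 : 0 ≤ t := by positivity
  have h1 := lint_all (t * σ) n inferInstance inferInstance μ inferInstance inferInstance
  have h2 : ∫⁻ U, FF (t * σ) U.1 ∂μ ≤ ENNReal.ofReal (Real.exp (t^2 / 4 * K)) := by
    refine h1.trans (ENNReal.ofReal_le_ofReal (Real.exp_le_exp.2 ?_))
    have h3 : (t * σ / 2)^2 = t^2/4 := by rw [div_pow, mul_pow, hσ]; ring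
    rw [h3]
    exact mul_le_mul_of_nonneg_left (TT_sum n hn) (by positivity)
  have h4 := meas_ge_le_lintegral_div (μ := μ) (FF_meas (ι := Fin n) (t * σ)).aemeasurable
    (ε := ENNReal.ofReal (Real.exp (t * x))) (by simp [Real.exp_pos]) ENNReal.ofReal_ne_top
  refine (measure_mono ?_).trans (h4.trans ?_)
  · rintro U ⟨hU, hxU⟩
    simp only [mem_setOf_eq, FF, if_pos hU]
    apply ENNReal.ofReal_le_ofReal
    apply Real.exp_le_exp.2
    rw [mul_assoc]
    exact mul_le_mul_of_nonneg_left hxU ht0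
  · refine (ENNReal.div_le_div_right h2 _).trans ?_
    rw [← ENNReal.ofReal_div_of_pos (Real.exp_pos _), ← Real.exp_sub]
    apply ENNReal.ofReal_le_ofReal
    apply Real.exp_le_exp.2
    apply le_of_eq
    rw [ht]; field_simp; ring

lemma root_unit {U : Matrix ι ι ℂ} (hU : U ∈ unitaryGroup ι ℂ) {l : ℂ} (hl : l ∈ U.charpoly.roots) :
    ‖l‖ = 1 := by
  have hl' : Module.End.HasEigenvalue (Matrix.toLin' U) l := by
    rw [Module.End.hasEigenvalue_iff_isRoot_charpoly, Matrix.charpoly_toLin']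
    exact (Polynomial.mem_roots'.1 hl).2
  obtain ⟨v, hv⟩ := hl'.exists_hasEigenvector
  have h1 := hv.apply_eq_smul
  rw [Matrix.toLin'_apply] at h1
  have h2 := unitary_norm hU v
  rw [h1] at h2
  simp only [Pi.smul_apply, smul_eq_mul, norm_mul, mul_pow, ← Finset.mul_sum] at h2
  have hne : ∑ i, ‖v i‖^2 ≠ 0 := by
    intro h
    apply hv.2
    rw [Finset.sum_eq_zero_iff_of_nonneg (fun _ _ => by positivity)] at h
    ext i
    simpa using h i (Finset.mem_univ _)
  have h3 : ‖l‖^2 = 1 := by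
    have : (‖l‖^2 - 1) * ∑ i, ‖v i‖^2 = 0 := by linear_combination h2
    rcases mul_eq_zero.1 this with h | h
    · linarith
    · exact absurd h hne
  exact (pow_eq_one_iff_of_nonneg (norm_nonneg _) (by norm_num)).1 h3

lemma X_eq {U : Matrix ι ι ℂ} (hU : U ∈ unitaryGroup ι ℂ) (hd : det (1 - U) ≠ 0) :
    (U.charpoly.roots.map (fun l => (Complex.log (1 - l⁻¹)).im)).sum = -(Lc 1 U).im := by
  have hg := good_unitary hU hd
  have h1 : ∀ l ∈ U.charpoly.roots, (Complex.log (1 - l⁻¹)).im = -(Complex.log (1 - (1:ℝ) * l)).im := by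
    intro l hl
    have h2 := slit_of 1 zero_le_one le_rfl l (hg l hl).1 (hg l hl).2
    have h3 : 1 - l⁻¹ = conj (1 - (1:ℝ) * l) := by
      rw [Complex.inv_eq_conj (root_unit hU hl)]; simp
    rw [h3, Complex.log_conj _ (Complex.slitPlane_arg_ne_pi h2), Complex.conj_im]
  rw [Multiset.map_congr rfl h1, Lc]
  generalize U.charpoly.roots = s
  induction s using Multiset.induction_on with
  | empty => simp
  | cons a s ih =>
    simp only [Multiset.map_cons, Multiset.sum_cons, Complex.add_im] at ih ⊢
    rw [ih]; ring

end integ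
end CB


theorem chernoff_bound_for_argument (n : ℕ) (hn : 1 ≤ n)
    (μ : Measure (Matrix.unitaryGroup (Fin n) ℂ))
    (hHaar : μ.IsHaarMeasure) (hprob : IsProbabilityMeasure μ)
    (X : Matrix.unitaryGroup (Fin n) ℂ → ℝ)
    (hX : ∀ U : Matrix.unitaryGroup (Fin n) ℂ,
      X U = ((Matrix.charpoly (U : Matrix (Fin n) (Fin n) ℂ)).roots.map
        (fun l => (Complex.log (1 - l⁻¹)).im)).sum)
    (x : ℝ) (hx : 0 < x) :
    μ {U : Matrix.unitaryGroup (Fin n) ℂ | x ≤ |X U|} ≤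
      ENNReal.ofReal (2 * Real.exp (-x ^ 2 / (π ^ 2 / 6 + 1 + Real.log n))) := by
  have h0 := CB.null_set μ
  have hp := CB.tail n hn μ x hx.le 1 (by norm_num)
  have hm := CB.tail n hn μ x hx.le (-1) (by norm_num)
  have hsub : {U : Matrix.unitaryGroup (Fin n) ℂ | x ≤ |X U|} ⊆
      {U | det (1 - U.1) = 0} ∪ ({U | det (1 - U.1) ≠ 0 ∧ x ≤ 1 * (CB.Lc 1 U.1).im} ∪
        {U | det (1 - U.1) ≠ 0 ∧ x ≤ (-1) * (CB.Lc 1 U.1).im}) := by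
    intro U hU
    by_cases hd : det (1 - U.1) = 0
    · exact Or.inl hd
    · right
      have h1 : x ≤ |X U| := hU
      rw [hX, CB.X_eq U.2 hd, abs_neg, le_abs] at h1
      rcases h1 with h | h
      · exact Or.inl ⟨hd, by rw [one_mul]; exact h⟩
      · exact Or.inr ⟨hd, by rw [neg_one_mul]; exact h⟩
  refine (measure_mono hsub).trans ((measure_union_le _ _).trans ?_)
  rw [h0, zero_add, two_mul, ENNReal.ofReal_add (Real.exp_pos _).le (Real.exp_pos _).le]
  exact (measure_union_le _ _).trans (add_le_add hp hm)
end

section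
/- For every real number λ and every integer n ≥ 1, the following identity and bound hold: Π_{k=1}^n Γ(k)² / (Γ(k + iλ/2)·Γ(k − iλ/2)) = Π_{k=1}^n Π_{j=0}^∞ (1 + λ²/(4(j+k)²)), and this quantity is at most exp((λ²/4)·(π²/6 + 1 + log n)). Here Γ denotes the complex Gamma function, and the left-hand side is a positive real number since Γ(k − iλ/2) is the complex conjugate of Γ(k + iλ/2). -/
open Complex Real Finset

lemma aux_summable (k : ℕ) : Summable (fun j : ℕ => 1 / ((j : ℝ) + (k + 1)) ^ 2) := by
  have h := (summable_nat_add_iff (f := fun n : ℕ => (1 : ℝ) / (n : ℝ) ^ 2) (k + 1)).2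
    hasSum_zeta_two.summable
  refine h.congr fun j => ?_
  push_cast
  rfl

lemma aux_eq (l : ℝ) (k j : ℕ) :
    l ^ 2 / (4 * ((j : ℝ) + (k + 1)) ^ 2) = l ^ 2 / 4 * (1 / ((j : ℝ) + (k + 1)) ^ 2) := by
  rw [div_mul_div_comm, mul_one]

lemma aux_mult (l : ℝ) (k : ℕ) :
    Multipliable (fun j : ℕ => 1 + l ^ 2 / (4 * ((j : ℝ) + (k + 1)) ^ 2)) := by
  apply Real.multipliable_one_add_of_summable
  simp_rw [aux_eq]
  exact (aux_summable k).mul_left _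

lemma aux_prod_le (l : ℝ) (k : ℕ) :
    ∏' j : ℕ, (1 + l ^ 2 / (4 * ((j : ℝ) + (k + 1)) ^ 2)) ≤
      Real.exp (l ^ 2 / 4 * ∑' j : ℕ, 1 / ((j : ℝ) + (k + 1)) ^ 2) := by
  refine le_of_tendsto (aux_mult l k).hasProd (Filter.Eventually.of_forall fun s => ?_)
  calc ∏ j ∈ s, (1 + l ^ 2 / (4 * ((j : ℝ) + (k + 1)) ^ 2))
      ≤ ∏ j ∈ s, Real.exp (l ^ 2 / 4 * (1 / ((j : ℝ) + (k + 1)) ^ 2)) := by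
        refine Finset.prod_le_prod (fun j _ => by positivity) fun j _ => ?_
        rw [aux_eq, add_comm]
        exact Real.add_one_le_exp _
    _ = Real.exp (l ^ 2 / 4 * ∑ j ∈ s, 1 / ((j : ℝ) + (k + 1)) ^ 2) := by
        rw [← Real.exp_sum, Finset.mul_sum]
    _ ≤ _ := by
        apply Real.exp_le_exp.2
        apply mul_le_mul_of_nonneg_left _ (by positivity)
        exact (aux_summable k).sum_le_tsum s fun j _ => by positivity

lemma aux_zero : ∑' j : ℕ, 1 / ((j : ℝ) + ((0 : ℕ) + 1)) ^ 2 = π ^ 2 / 6 := by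
  have h := hasSum_zeta_two
  rw [← hasSum_nat_add_iff' 1] at h
  simpa using h.tsum_eq

lemma aux_succ (k : ℕ) : ∑' j : ℕ, 1 / ((j : ℝ) + ((k + 1 : ℕ) + 1)) ^ 2 ≤ 1 / ((k : ℝ) + 1) := by
  have key : ∀ N : ℕ, ∑ j ∈ Finset.range N, 1 / ((j : ℝ) + ((k + 1 : ℕ) + 1)) ^ 2 ≤
      1 / ((k : ℝ) + 1) - 1 / ((k : ℝ) + 1 + N) := by
    intro N
    induction N with
    | zero => simp
    | succ N ih =>
      rw [Finset.sum_range_succ]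
      have : 1 / ((N : ℝ) + ((k + 1 : ℕ) + 1)) ^ 2 ≤
          1 / ((k : ℝ) + 1 + N) - 1 / ((k : ℝ) + 1 + (N + 1 : ℕ)) := by
        push_cast
        have h : (0 : ℝ) < (k : ℝ) + 1 + N := by positivity
        have e : (N : ℝ) + (k + 1 + 1) = (k + 1 + N) + 1 := by ring
        have e' : (k : ℝ) + 1 + (N + 1) = (k + 1 + N) + 1 := by ring
        rw [e, e']
        generalize (k : ℝ) + 1 + N = x at h
        rw [div_sub_div _ _ (by positivity) (by positivity), div_le_div_iff₀ (by positivity) (by positivity)]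
        nlinarith
      linarith
  refine Real.tsum_le_of_sum_range_le (fun j => by positivity) fun N => (key N).trans ?_
  have : (0 : ℝ) ≤ 1 / ((k : ℝ) + 1 + N) := by positivity
  linarith

lemma aux_sum (m : ℕ) : ∑ k ∈ Finset.range (m + 1), ∑' j : ℕ, 1 / ((j : ℝ) + (k + 1)) ^ 2 ≤
    π ^ 2 / 6 + (harmonic m : ℝ) := by
  induction m with
  | zero => simpa using aux_zero.le
  | succ m ih =>
    rw [Finset.sum_range_succ, harmonic_succ]
    have := aux_succ m
    push_cast at this ⊢
    rw [one_div ((m : ℝ) + 1)] at this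
    linarith

lemma aux_bound (n : ℕ) (hn : 1 ≤ n) :
    ∑ k ∈ Finset.range n, ∑' j : ℕ, 1 / ((j : ℝ) + (k + 1)) ^ 2 ≤
      π ^ 2 / 6 + 1 + Real.log n := by
  obtain ⟨m, rfl⟩ := Nat.exists_eq_add_of_le' hn
  have h1 := aux_sum m
  have h2 := harmonic_le_one_add_log (m + 1)
  rw [harmonic_succ] at h2
  push_cast at h2 ⊢
  have : (0 : ℝ) ≤ ((m : ℝ) + 1)⁻¹ := by positivity
  linarith

lemma aux_gamma (l : ℝ) (k : ℕ) :
    (Complex.Gamma ((k : ℂ) + 1)) ^ 2 /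
          (Complex.Gamma (((k : ℂ) + 1) + Complex.I * l / 2) *
            Complex.Gamma (((k : ℂ) + 1) - Complex.I * l / 2)) =
    ((∏' j : ℕ, (1 + l ^ 2 / (4 * ((j : ℝ) + (k + 1)) ^ 2)) : ℝ) : ℂ) := by
  have hre : ∀ (s : ℝ) (j : ℕ), ((k : ℂ) + 1) + s * (Complex.I * l / 2) + j ≠ 0 := by
    intro s j h
    have := congrArg Complex.re h
    simp at this
    have h' : (0 : ℝ) < (k : ℝ) + 1 + j := by positivity
    linarith
  have hG : ∀ s : ℝ, Complex.Gamma (((k : ℂ) + 1) + s * (Complex.I * l / 2)) ≠ 0 := by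
    intro s
    apply Complex.Gamma_ne_zero
    intro m h
    exact hre s m (by rw [h]; ring)
  have hp := hre 1
  have hm := hre (-1)
  have gp := hG 1
  have gm := hG (-1)
  simp only [Complex.ofReal_one, one_mul, Complex.ofReal_neg, neg_mul, ← sub_eq_add_neg] at hp hm gp gm
  have lim1 := ((Complex.GammaSeq_tendsto_Gamma ((k : ℂ) + 1)).pow 2).div
    ((Complex.GammaSeq_tendsto_Gamma (((k : ℂ) + 1) + Complex.I * l / 2)).mul
      (Complex.GammaSeq_tendsto_Gamma (((k : ℂ) + 1) - Complex.I * l / 2))) (mul_ne_zero gp gm)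
  have lim2 := (Complex.continuous_ofReal.tendsto _).comp
    ((aux_mult l k).hasProd.tendsto_prod_nat.comp (Filter.tendsto_add_atTop_nat 1))
  refine tendsto_nhds_unique lim1 (lim2.congr' ?_)
  filter_upwards [Filter.eventually_ne_atTop 0] with N hN
  have hN' : (N : ℂ) ≠ 0 := by exact_mod_cast hN
  have hf : (N.factorial : ℂ) ≠ 0 := by exact_mod_cast N.factorial_ne_zero
  have hpow : (N : ℂ) ^ (((k : ℂ) + 1) + Complex.I * l / 2) *
      (N : ℂ) ^ (((k : ℂ) + 1) - Complex.I * l / 2) = ((N : ℂ) ^ ((k : ℂ) + 1)) ^ 2 := by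
    rw [← Complex.cpow_add _ _ hN', sq, ← Complex.cpow_add _ _ hN']
    congr 1; ring
  have hprod : ∏ j ∈ Finset.range (N + 1), ((1 : ℂ) + l ^ 2 / (4 * ((j : ℂ) + (k + 1)) ^ 2)) =
      ((∏ j ∈ Finset.range (N + 1), (((k : ℂ) + 1) + Complex.I * l / 2 + j)) *
      ∏ j ∈ Finset.range (N + 1), (((k : ℂ) + 1) - Complex.I * l / 2 + j)) /
      (∏ j ∈ Finset.range (N + 1), (((k : ℂ) + 1) + j)) ^ 2 := by
    rw [← Finset.prod_mul_distrib, ← Finset.prod_pow, ← Finset.prod_div_distrib]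
    refine Finset.prod_congr rfl fun j _ => ?_
    have h0 : ((k : ℂ) + 1) + j ≠ 0 := by exact_mod_cast (by positivity : (k + 1 + j : ℕ) ≠ 0)
    have e : (j : ℂ) + (k + 1) = k + 1 + j := by ring
    rw [e]
    have e2 : (((k : ℂ) + 1) + Complex.I * l / 2 + j) * (((k : ℂ) + 1) - Complex.I * l / 2 + j)
      = (k + 1 + j) ^ 2 + l ^ 2 / 4 := by
      linear_combination (-(l : ℂ) ^ 2 / 4) * Complex.I_sq
    rw [e2]
    field_simp
  have n0 : ∏ j ∈ Finset.range (N + 1), (((k : ℂ) + 1) + j) ≠ 0 :=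
    Finset.prod_ne_zero_iff.2 fun j _ => by
      exact_mod_cast (by positivity : (k + 1 + j : ℕ) ≠ 0)
  have n1 := Finset.prod_ne_zero_iff.2 fun j (_ : j ∈ Finset.range (N + 1)) => hp j
  have n2 := Finset.prod_ne_zero_iff.2 fun j (_ : j ∈ Finset.range (N + 1)) => hm j
  have c0 : (N : ℂ) ^ ((k : ℂ) + 1) ≠ 0 := by simp [Complex.cpow_eq_zero_iff, hN']
  simp only [Function.comp, Pi.div_apply, Pi.mul_apply, Pi.pow_apply, Complex.GammaSeq]
  push_cast
  rw [hprod, div_mul_div_comm, mul_mul_mul_comm, hpow]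
  field_simp

theorem gamma_moment_identity_and_bound (l : ℝ) (n : ℕ) (hn : 1 ≤ n) :
    (∀ k : ℕ, Multipliable (fun j : ℕ => 1 + l ^ 2 / (4 * ((j : ℝ) + (k + 1)) ^ 2))) ∧
    (∏ k ∈ Finset.range n,
        (Complex.Gamma ((k : ℂ) + 1)) ^ 2 /
          (Complex.Gamma (((k : ℂ) + 1) + Complex.I * l / 2) *
            Complex.Gamma (((k : ℂ) + 1) - Complex.I * l / 2))) =
      ((∏ k ∈ Finset.range n,
        ∏' j : ℕ, (1 + l ^ 2 / (4 * ((j : ℝ) + (k + 1)) ^ 2)) : ℝ) : ℂ) ∧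
    (∏ k ∈ Finset.range n, ∏' j : ℕ, (1 + l ^ 2 / (4 * ((j : ℝ) + (k + 1)) ^ 2))) ≤
      Real.exp (l ^ 2 / 4 * (π ^ 2 / 6 + 1 + Real.log n)) := by
  refine ⟨aux_mult l, ?_, ?_⟩
  · rw [Complex.ofReal_prod]
    exact Finset.prod_congr rfl fun k _ => aux_gamma l k
  · calc _ ≤ ∏ k ∈ Finset.range n,
          Real.exp (l ^ 2 / 4 * ∑' j : ℕ, 1 / ((j : ℝ) + (k + 1)) ^ 2) := by
          refine Finset.prod_le_prod (fun k _ => ?_) fun k _ => aux_prod_le l k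
          exact ge_of_tendsto (aux_mult l k).hasProd (Filter.Eventually.of_forall fun s =>
            Finset.prod_nonneg fun j _ => by positivity)
      _ = Real.exp (l ^ 2 / 4 * ∑ k ∈ Finset.range n,
          ∑' j : ℕ, 1 / ((j : ℝ) + (k + 1)) ^ 2) := by
          rw [← Real.exp_sum, Finset.mul_sum]
      _ ≤ _ := Real.exp_le_exp.2
          (mul_le_mul_of_nonneg_left (aux_bound n hn) (by positivity))
end
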